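/- arXiv:1504.05756 — 2 statements merged into one kernel-verified Lean document; each statement's English description precedes it below -/
import Mathlib

section
/- Reduction to fixed key rate and zero excess-distortion on a type class: Let 𝒳, 𝒲, 𝒵, P, d_L, d_E be as in the converse setting (P of full support, per-letter zero-distortion reproductions existing, d_E more lenient than d_L), and let S = {(k_n, f_n, φ_n)} be a sequence of variable key rate secure rate-distortion codes satisfying the compression constraint (Rc, Dc, Ec) with Ec > 0, with admissible encoders, with k_n(x) ≤ n log₂|𝒳| for all x, and with uniform convergence in probability of the conditional key rates k_n(X)/n to R̄(Q) given X ∈ T_n(Q). Let Q ∈ 𝒫(𝒳) with full support on 𝒳 satisfy D(Q‖P) < Ec, and let δ > 0. Then there exists a sequence of secure rate-distortion codes S* = {(k*_n, f*_n, φ*_n)} such that: (1) for all n and all x ∈ T_n(Q), k*_n(x) = ⌈n R*⌉ for a constant R* ≤ R̄(Q) + δ; (2) for all n, all keys u, and all x ∈ T_n(Q), d_L(x, φ*_n(f*_n(x,u),u)) ≤ Dc (zero conditional excess-distortion probability), and S* satisfies the compression constraint (log₂|𝒳|, Dc, Ec); and (3) for every D ≥ Dc, the conditional limsup exiguous-distortion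 exponents given X ∈ T_n(Q) satisfy E_d^+(S,D,Q) ≤ E_d^+(S*,D,Q) + δ. -/
open scoped BigOperators

noncomputable section

open Classical in
/-- Indicator of a proposition, as a real number. -/
def ind (p : Prop) : ℝ := if p then 1 else 0

/-- Average per-letter distortion between sequences. -/
def seqDist {A B : Type*} (d : A → B → ℝ) {n : ℕ} (x : Fin n → A) (z : Fin n → B) : ℝ :=
  (n : ℝ)⁻¹ * ∑ i, d (x i) (z i)

/-- Empirical distribution (type) of a sequence. -/
def empDist {A : Type*} [Fintype A] [DecidableEq A] {n : ℕ} (x : Fin n → A) : A → ℝ :=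
  fun a => ((Finset.univ.filter fun i => x i = a).card : ℝ) / n

/-- Type class of `Q` among length-`n` sequences. -/
def typeClass (A : Type*) [Fintype A] [DecidableEq A] (n : ℕ) (Q : A → ℝ) :
    Set (Fin n → A) := {x | empDist x = Q}

/-- `p` is a probability distribution on a finite alphabet. -/
def IsDist {A : Type*} [Fintype A] (p : A → ℝ) : Prop :=
  (∀ a, 0 ≤ p a) ∧ ∑ a, p a = 1

/-- Information divergence (base 2). -/
def KL {A : Type*} [Fintype A] (Q P : A → ℝ) : ℝ := ∑ a, Q a * Real.logb 2 (Q a / P a)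

/-- Extension of a finite key string to an infinite key stream (padding with `false`). -/
def extKey {K : ℕ} (u : Fin K → Bool) : ℕ → Bool :=
  fun i => if h : i < K then u ⟨i, h⟩ else false

/-- The maximal (over eavesdroppers) conditional exiguous-distortion probability of a
blocklength-`n` code, given that the source block is in `T_n(Q)` (the source is then uniform
on `T_n(Q)` and the key bits are independent fair bits). -/
def condExigProb {𝓧 𝓩 M : Type*} [Fintype 𝓧] [DecidableEq 𝓧] [Fintype 𝓩] [Fintype M]
    (dE : 𝓧 → 𝓩 → ℝ) (D : ℝ) (Q : 𝓧 → ℝ) {n : ℕ}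
    (k : (Fin n → 𝓧) → ℕ) (f : (Fin n → 𝓧) → (ℕ → Bool) → M) : ℝ :=
  ⨆ σ : M → (Fin n → 𝓩),
    (((typeClass 𝓧 n Q).ncard : ℝ) * (2 : ℝ) ^ (Finset.univ.sup k : ℕ))⁻¹ *
      ∑ x : Fin n → 𝓧, ∑ u : Fin (Finset.univ.sup k) → Bool,
        ind (x ∈ typeClass 𝓧 n Q ∧ seqDist dE x (σ (f x (extKey u))) ≤ D)

/-- averaging: some group element moves at least half of `C` into `A` -/
lemma cover_step {Ω I : Type*} [Fintype Ω] [DecidableEq Ω] [Fintype I] [Nonempty I]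
    (act : I → Ω ≃ Ω)
    (hact : ∀ c c' : Ω, ∃ e : I ≃ I, ∀ i, act i c' = act (e i) c)
    (A : Finset Ω) (hA : Fintype.card Ω ≤ 2 * A.card) (C : Finset Ω) :
    ∃ i, 2 * (C.filter fun c => act i c ∉ A).card ≤ C.card := by
  classical
  rcases C.eq_empty_or_nonempty with rfl | ⟨c0, hc0⟩
  · exact ⟨Classical.arbitrary I, by simp⟩
  have hΩ : 0 < Fintype.card Ω := Fintype.card_pos_iff.mpr ⟨c0⟩
  -- the number of group elements moving `c` out of `A` does not depend on `c`
  set r : ℕ := (Finset.univ.filter fun i => act i c0 ∉ A).card with hr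
  have hconst : ∀ c, (Finset.univ.filter fun i => act i c ∉ A).card = r := by
    intro c
    obtain ⟨e, he⟩ := hact c0 c
    rw [hr]
    refine Finset.card_bij (fun i _ => e i) ?_ ?_ ?_
    · intro i hi
      simpa [he] using hi
    · intro i _ j _ h
      exact e.injective h
    · intro j hj
      refine ⟨e.symm j, ?_, by simp⟩
      simpa [he] using hj
  have hdbl : ∀ S : Finset Ω, ∑ i : I, (S.filter fun c => act i c ∉ A).card = S.card * r := by
    intro S
    have : ∀ i : I, (S.filter fun c => act i c ∉ A).card = ∑ c ∈ S, if act i c ∉ A then 1 else 0 := by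
      intro i; rw [Finset.card_filter]
    simp_rw [this]
    rw [Finset.sum_comm]
    have : ∀ c ∈ S, (∑ i : I, if act i c ∉ A then 1 else 0) = r := by
      intro c _
      rw [← hconst c, Finset.card_filter]
    rw [Finset.sum_congr rfl this]; simp
  have huniv := hdbl Finset.univ
  have h1 : ∀ i : I, (Finset.univ.filter fun c => act i c ∉ A).card = Fintype.card Ω - A.card := by
    intro i
    rw [← Finset.card_compl]
    refine Finset.card_bij (fun c _ => act i c) ?_ ?_ ?_
    · intro c hc; simpa using hc
    · intro c _ d _ h; exact (act i).injective h
    · intro d hd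
      exact ⟨(act i).symm d, by simpa using hd, by simp⟩
  simp_rw [h1] at huniv
  simp only [Finset.sum_const, Finset.card_univ, smul_eq_mul] at huniv
  have h2 : 2 * r ≤ Fintype.card I := by
    have : Fintype.card Ω * (2 * r) ≤ Fintype.card Ω * Fintype.card I := by
      calc Fintype.card Ω * (2 * r) = Fintype.card I * (2 * (Fintype.card Ω - A.card)) := by
            rw [show Fintype.card Ω * (2 * r) = 2 * (Fintype.card Ω * r) by ring, ← huniv]; ring
        _ ≤ Fintype.card I * Fintype.card Ω := by
            apply Nat.mul_le_mul_left; omega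
        _ = _ := by ring
    exact Nat.le_of_mul_le_mul_left this hΩ
  by_contra hcon
  push Not at hcon
  have h3 : ∑ i : I, C.card < ∑ i : I, 2 * (C.filter fun c => act i c ∉ A).card :=
    Finset.sum_lt_sum_of_nonempty Finset.univ_nonempty (fun i _ => hcon i)
  rw [← Finset.mul_sum, hdbl] at h3
  simp only [Finset.sum_const, Finset.card_univ, smul_eq_mul] at h3
  have : C.card * (2 * r) ≤ C.card * Fintype.card I := Nat.mul_le_mul_left _ h2
  nlinarith

lemma cover_aux {Ω I : Type*} [Fintype Ω] [DecidableEq Ω] [Fintype I] [Nonempty I]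
    (act : I → Ω ≃ Ω)
    (hact : ∀ c c' : Ω, ∃ e : I ≃ I, ∀ i, act i c' = act (e i) c)
    (A : Finset Ω) (hA : Fintype.card Ω ≤ 2 * A.card) (N : ℕ) :
    ∀ C : Finset Ω, C.card < 2 ^ N → ∃ g : Fin N → I, ∀ ω ∈ C, ∃ j, act (g j) ω ∈ A := by
  induction N with
  | zero =>
    intro C hC
    have : C = ∅ := by simpa using hC
    subst this
    exact ⟨fun _ => Classical.arbitrary I, by simp⟩
  | succ N ih =>
    intro C hC
    obtain ⟨i, hi⟩ := cover_step act hact A hA C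
    obtain ⟨g, hg⟩ := ih (C.filter fun c => act i c ∉ A) (by rw [pow_succ] at hC; omega)
    refine ⟨Fin.cons i g, ?_⟩
    intro ω hω
    by_cases h : act i ω ∈ A
    · exact ⟨0, by simpa using h⟩
    · obtain ⟨j, hj⟩ := hg ω (by simp [hω, h])
      exact ⟨j.succ, by simpa using hj⟩

/-- random hashing: there is a hash function with few collisions -/
lemma hash_exists {T K Y : Type*} [Fintype T] [Fintype K] [Fintype Y] [DecidableEq Y] 
    [DecidableEq T] [DecidableEq K] (M : ℕ) (hM : 0 < M) (F : T → K → Y) :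
    ∃ h : Y → Fin M,
      (Finset.univ.filter fun q : T × K =>
        ∃ x', F x' q.2 ≠ F q.1 q.2 ∧ h (F x' q.2) = h (F q.1 q.2)).card * M
        ≤ Fintype.card T * Fintype.card T * Fintype.card K := by
  classical
  have : Nonempty (Fin M) := ⟨⟨0, hM⟩⟩
  -- pair collision count
  have hpair : ∀ y y' : Y, y ≠ y' →
      (Finset.univ.filter fun h : Y → Fin M => h y = h y').card * M ≤ Fintype.card (Y → Fin M) := by
    intro y y' hy
    have : (Finset.univ.filter fun h : Y → Fin M => h y = h y').card * M =
        ((Finset.univ.filter fun h : Y → Fin M => h y = h y') ×ˢ (Finset.univ : Finset (Fin M))).card := by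
      simp [Finset.card_product]
    rw [this, ← Finset.card_univ]
    refine Finset.card_le_card_of_injOn (fun p => Function.update p.1 y p.2) (by simp) ?_
    rintro ⟨h1, c1⟩ hh1 ⟨h2, c2⟩ hh2 heq
    simp only [Finset.coe_product, Set.mem_prod, Finset.mem_coe, Finset.mem_filter,
      Finset.mem_univ, true_and, and_true] at hh1 hh2
    simp only at heq
    have hc : c1 = c2 := by simpa using congrFun heq y
    have hoff : ∀ z, z ≠ y → h1 z = h2 z := by
      intro z hz
      have := congrFun heq z
      simpa [Function.update_of_ne hz] using this
    have : h1 = h2 := by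
      funext z
      by_cases hz : z = y
      · subst hz; rw [hh1, hh2]; exact hoff _ (Ne.symm hy)
      · exact hoff z hz
    rw [this, hc]
  by_contra hcon
  push Not at hcon
  have hlt : ∑ h : Y → Fin M, Fintype.card T * Fintype.card T * Fintype.card K <
      ∑ h : Y → Fin M, (Finset.univ.filter fun q : T × K =>
        ∃ x', F x' q.2 ≠ F q.1 q.2 ∧ h (F x' q.2) = h (F q.1 q.2)).card * M :=
    Finset.sum_lt_sum_of_nonempty Finset.univ_nonempty (fun h _ => hcon h)
  have hle : ∀ h : Y → Fin M, (Finset.univ.filter fun q : T × K =>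
        ∃ x', F x' q.2 ≠ F q.1 q.2 ∧ h (F x' q.2) = h (F q.1 q.2)).card ≤
        ∑ q : T × K, ∑ x' : T, if F x' q.2 ≠ F q.1 q.2 ∧ h (F x' q.2) = h (F q.1 q.2) then 1 else 0 := by
    intro h
    rw [Finset.card_filter]
    refine Finset.sum_le_sum fun q _ => ?_
    split_ifs with hq
    · obtain ⟨x', hx'⟩ := hq
      calc 1 = if F x' q.2 ≠ F q.1 q.2 ∧ h (F x' q.2) = h (F q.1 q.2) then 1 else 0 := by rw [if_pos hx']
        _ ≤ _ := Finset.single_le_sum (f := fun x' => if F x' q.2 ≠ F q.1 q.2 ∧ h (F x' q.2) = h (F q.1 q.2) then 1 else 0) (fun _ _ => Nat.zero_le _) (Finset.mem_univ x')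
    · exact Nat.zero_le _
  have hup : ∑ h : Y → Fin M, (Finset.univ.filter fun q : T × K =>
        ∃ x', F x' q.2 ≠ F q.1 q.2 ∧ h (F x' q.2) = h (F q.1 q.2)).card * M ≤
      ∑ q : T × K, ∑ x' : T, Fintype.card (Y → Fin M) := by
    calc _ ≤ ∑ h : Y → Fin M, (∑ q : T × K, ∑ x' : T, if F x' q.2 ≠ F q.1 q.2 ∧ h (F x' q.2) = h (F q.1 q.2) then 1 else 0) * M :=
          Finset.sum_le_sum fun h _ => Nat.mul_le_mul_right _ (hle h)
      _ = ∑ q : T × K, ∑ x' : T, (∑ h : Y → Fin M, if F x' q.2 ≠ F q.1 q.2 ∧ h (F x' q.2) = h (F q.1 q.2) then 1 else 0) * M := by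
          rw [← Finset.sum_mul, Finset.sum_comm, Finset.sum_mul]
          refine Finset.sum_congr rfl fun q _ => ?_
          rw [Finset.sum_comm, Finset.sum_mul]
      _ ≤ _ := by
          refine Finset.sum_le_sum fun q _ => Finset.sum_le_sum fun x' _ => ?_
          by_cases hne : F x' q.2 = F q.1 q.2
          · simp [hne]
          · refine le_trans ?_ (hpair _ _ hne)
            rw [Finset.card_filter]
            simp [hne]
  have := lt_of_lt_of_le hlt hup
  simp only [Finset.sum_const, Finset.card_univ, smul_eq_mul, Fintype.card_prod] at this
  apply lt_irrefl _ (lt_of_lt_of_le this (le_of_eq _))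
  ring

lemma comp_mem_typeClass {A : Type*} [Fintype A] [DecidableEq A] {n : ℕ} {Q : A → ℝ}
    {x : Fin n → A} (hx : x ∈ typeClass A n Q) (π : Equiv.Perm (Fin n)) :
    x ∘ π ∈ typeClass A n Q := by
  have : empDist (x ∘ π) = empDist x := by
    funext a
    unfold empDist
    congr 2
    refine Finset.card_bij (fun i _ => π i) ?_ ?_ ?_
    · intro i hi; simpa using hi
    · intro i _ j _ h; exact π.injective h
    · intro j hj; exact ⟨π.symm j, by simpa using hj, by simp⟩
  show empDist (x ∘ π) = Q
  rw [this]; exact hx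

lemma typeClass_card_eq {A : Type*} [Fintype A] [DecidableEq A] {n : ℕ} (hn : 0 < n) {Q : A → ℝ}
    {x : Fin n → A} (hx : x ∈ typeClass A n Q) (a : A) :
    (Fintype.card {i // x i = a} : ℝ) = n * Q a := by
  have h : empDist x = Q := hx
  rw [← h]
  unfold empDist
  rw [Fintype.card_subtype]
  field_simp

lemma typeClass_trans {A : Type*} [Fintype A] [DecidableEq A] {n : ℕ} (hn : 0 < n) {Q : A → ℝ}
    {x x' : Fin n → A} (hx : x ∈ typeClass A n Q) (hx' : x' ∈ typeClass A n Q) :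
    ∃ τ : Equiv.Perm (Fin n), x' = x ∘ τ := by
  have hc : ∀ a, Fintype.card {i // x' i = a} = Fintype.card {i // x i = a} := by
    intro a
    have h1 := typeClass_card_eq hn hx a
    have h2 := typeClass_card_eq hn hx' a
    exact_mod_cast h2.trans h1.symm
  refine ⟨Equiv.ofFiberEquiv (fun a => Fintype.equivOfCardEq (hc a)), ?_⟩
  funext i
  exact (Equiv.ofFiberEquiv_map _ i).symm

lemma seqDist_comp {A B : Type*} (d : A → B → ℝ) {n : ℕ} (x : Fin n → A) (z : Fin n → B)
    (π : Equiv.Perm (Fin n)) : seqDist d (x ∘ π) (z ∘ π) = seqDist d x z := by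
  unfold seqDist
  congr 1
  exact Equiv.sum_comp π (fun i => d (x i) (z i))

lemma ind_nonneg (p : Prop) : 0 ≤ ind p := by unfold ind; split_ifs <;> norm_num
lemma ind_le_one (p : Prop) : ind p ≤ 1 := by unfold ind; split_ifs <;> norm_num
lemma ind_pos' {p : Prop} (h : p) : ind p = 1 := by unfold ind; rw [if_pos h]
lemma ind_neg' {p : Prop} (h : ¬ p) : ind p = 0 := by unfold ind; rw [if_neg h]
lemma ind_mono {p q : Prop} (h : p → q) : ind p ≤ ind q := by
  by_cases hp : p
  · rw [ind_pos' hp, ind_pos' (h hp)]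
  · rw [ind_neg' hp]; exact ind_nonneg q

/-- key averaging -/
lemma key_avg {g : (ℕ → Bool) → ℝ} {k K : ℕ} (hk : k ≤ K)
    (hg : ∀ u u' : ℕ → Bool, (∀ i < k, u i = u' i) → g u = g u') :
    ∑ p : Fin K → Bool, g (extKey p) = (2:ℝ)^K * ((2:ℝ)^k)⁻¹ * ∑ q : Fin k → Bool, g (extKey q) := by
  obtain ⟨r, rfl⟩ := Nat.exists_eq_add_of_le hk
  rw [← Equiv.sum_comp (Fin.appendEquiv k r), Fintype.sum_prod_type]
  have : ∀ (q : Fin k → Bool) (s : Fin r → Bool),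
      g (extKey (Fin.appendEquiv k r (q, s))) = g (extKey q) := by
    intro q s
    apply hg
    intro i hi
    have hi' : i < k + r := by omega
    unfold extKey
    rw [dif_pos hi, dif_pos hi']
    have : (⟨i, hi'⟩ : Fin (k + r)) = Fin.castAdd r ⟨i, hi⟩ := rfl
    rw [this]
    exact Fin.append_left q s ⟨i, hi⟩
  simp only [this]
  simp only [Finset.sum_const, Finset.card_univ, Fintype.card_fun, Fintype.card_fin,
    Fintype.card_bool, nsmul_eq_mul]
  rw [← Finset.mul_sum, pow_add]
  push_cast
  field_simp

lemma factorial_upper (c : ℕ) (hc : 1 ≤ c) :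
    (c.factorial : ℝ) ≤ Real.exp 1 * c * ((c:ℝ) / Real.exp 1) ^ c := by
  induction c, hc using Nat.le_induction with
  | base => simp; 
  | succ c hc ih =>
    have hc0 : (0:ℝ) < c := by exact_mod_cast hc
    have he : (0:ℝ) < Real.exp 1 := Real.exp_pos 1
    have h1 : Real.exp (1 / ((c:ℝ) + 1)) ≤ ((c:ℝ) + 1) / c := by
      have h := Real.log_le_sub_one_of_pos (show (0:ℝ) < c / (c+1) by positivity)
      have h2 : (1 / ((c:ℝ) + 1)) ≤ Real.log (((c:ℝ) + 1) / c) := by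
        rw [← inv_div (c:ℝ) ((c:ℝ) + 1), Real.log_inv]
        have : (c:ℝ) / (c+1) - 1 = - (1/(c+1)) := by field_simp; ring
        linarith
      calc _ ≤ Real.exp (Real.log (((c:ℝ) + 1) / c)) := Real.exp_le_exp.mpr h2
        _ = _ := Real.exp_log (by positivity)
    have h2 : Real.exp 1 ≤ (((c:ℝ) + 1) / c) ^ (c+1) := by
      calc Real.exp 1 = Real.exp (1 / ((c:ℝ) + 1)) ^ (c+1) := by
            rw [← Real.exp_nat_mul]; congr 1; push_cast; field_simp
        _ ≤ _ := by gcongr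
    rw [div_pow, le_div_iff₀ (by positivity)] at h2
    rw [Nat.factorial_succ]
    push_cast
    calc ((c:ℝ)+1) * (c.factorial:ℝ) ≤ ((c:ℝ)+1) * (Real.exp 1 * c * ((c:ℝ) / Real.exp 1) ^ c) := by gcongr
      _ = ((c:ℝ)+1) * (Real.exp 1 * (c:ℝ)^(c+1)) / (Real.exp 1)^c := by rw [div_pow, pow_succ]; field_simp
      _ ≤ ((c:ℝ)+1) * ((c:ℝ)+1)^(c+1) / (Real.exp 1)^c := by gcongr
      _ = _ := by rw [div_pow]; field_simp; ring

lemma factorial_lower (n : ℕ) (hn : 0 < n) : ((n:ℝ) / Real.exp 1) ^ n ≤ (n.factorial : ℝ) := by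
  refine le_trans ?_ (Stirling.le_factorial_stirling n)
  have h1 : (1:ℝ) ≤ √(2 * Real.pi * n) := by
    rw [Real.one_le_sqrt]
    have := Real.pi_gt_three
    have hn' : (1:ℝ) ≤ n := by exact_mod_cast hn
    nlinarith
  have : (0:ℝ) ≤ ((n:ℝ) / Real.exp 1) ^ n := by positivity
  nlinarith

lemma typeClass_orbit {A : Type*} [Fintype A] [DecidableEq A] {n : ℕ} (hn : 0 < n) {Q : A → ℝ}
    {x : Fin n → A} (hx : x ∈ typeClass A n Q) :
    n.factorial ≤ (∏ a, (Fintype.card {i // x i = a}).factorial) * (typeClass A n Q).ncard := by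
  classical
  rw [← DomMulAct.stabilizer_card x, Set.ncard_eq_toFinset_card']
  have := Finset.card_le_mul_card_image_of_maps_to (s := (Finset.univ : Finset (Equiv.Perm (Fin n))))
    (t := (typeClass A n Q).toFinset) (f := fun σ : Equiv.Perm (Fin n) => x ∘ σ)
    (fun σ _ => by simpa using comp_mem_typeClass hx σ) 
    (Fintype.card {g : Equiv.Perm (Fin n) // x ∘ g = x}) ?_
  · simpa [Fintype.card_perm] using this
  · intro t ht
    obtain ⟨τ, rfl⟩ := typeClass_trans hn hx (by simpa using ht : t ∈ typeClass A n Q)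
    rw [Fintype.card_subtype]
    refine Finset.card_le_card_of_injOn (fun σ : Equiv.Perm (Fin n) => σ * τ⁻¹) ?_ ?_
    · intro σ hσ
      simp only [Finset.coe_filter, Finset.mem_univ, true_and, Set.mem_ofPred_eq] at hσ ⊢
      funext i
      have := congrFun hσ (τ⁻¹ i)
      simpa using this
    · intro σ _ σ' _ h
      simpa using h

lemma prod_fiber {A : Type*} [Fintype A] [DecidableEq A] {n : ℕ} (x : Fin n → A) (R : A → ℝ) :
    ∏ i, R (x i) = ∏ a, R a ^ (Fintype.card {i // x i = a}) := by
  rw [← Finset.prod_fiberwise Finset.univ x]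
  refine Finset.prod_congr rfl fun a _ => ?_
  rw [Finset.prod_congr rfl (g := fun _ => R a), Finset.prod_const, Fintype.card_subtype]
  intro i hi
  simp at hi; rw [hi]

lemma sum_fiber {A : Type*} [Fintype A] [DecidableEq A] {n : ℕ} (x : Fin n → A) :
    ∑ a, (Fintype.card {i // x i = a}) = n := by
  have := Finset.card_eq_sum_card_fiberwise (s := (Finset.univ : Finset (Fin n))) (t := Finset.univ) (f := x) (by simp)
  simp only [Finset.card_univ, Fintype.card_fin] at this
  refine Eq.trans ?_ this.symm
  exact Finset.sum_congr rfl fun a _ => by rw [Fintype.card_subtype]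

lemma type_bound {A : Type*} [Fintype A] [DecidableEq A] {n : ℕ} (hn : 0 < n) {Q : A → ℝ}
    (hQ : ∀ a, 0 < Q a) {x : Fin n → A} (hx : x ∈ typeClass A n Q) :
    1 ≤ ((typeClass A n Q).ncard : ℝ) * (∏ i, Q (x i)) * (Real.exp 1 * n) ^ Fintype.card A := by
  have horb := typeClass_orbit hn hx
  have hn0 : (0:ℝ) < n := by exact_mod_cast hn
  have he : (0:ℝ) < Real.exp 1 := Real.exp_pos 1
  set c : A → ℕ := fun a => Fintype.card {i // x i = a} with hc
  have hcQ : ∀ a, (c a : ℝ) = n * Q a := fun a => typeClass_card_eq hn hx a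
  have hc1 : ∀ a, 1 ≤ c a := by
    intro a
    have : (0:ℝ) < c a := by rw [hcQ]; exact mul_pos hn0 (hQ a)
    exact_mod_cast this
  have hsum : ∑ a, c a = n := sum_fiber x
  have hcn : ∀ a, (c a : ℝ) ≤ n := by
    intro a
    have : c a ≤ ∑ a, c a := Finset.single_le_sum (fun _ _ => Nat.zero_le _) (Finset.mem_univ a)
    rw [hsum] at this
    exact_mod_cast this
  rw [prod_fiber x Q]
  have hprod : (∏ a, ((c a).factorial : ℝ)) ≤
      (Real.exp 1 * n) ^ Fintype.card A * (((n:ℝ) / Real.exp 1) ^ n * ∏ a, Q a ^ c a) := by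
    calc (∏ a, ((c a).factorial : ℝ)) ≤ ∏ a, ((Real.exp 1 * n) * (((n:ℝ)/Real.exp 1) ^ c a * Q a ^ c a)) := by
          refine Finset.prod_le_prod (fun _ _ => by positivity) fun a _ => ?_
          refine (factorial_upper (c a) (hc1 a)).trans ?_
          rw [← mul_pow]
          have : (c a : ℝ) / Real.exp 1 = (n:ℝ) / Real.exp 1 * Q a := by rw [hcQ]; ring
          rw [this]
          have := hcn a
          have := hQ a
          gcongr
      _ = _ := by
          rw [Finset.prod_mul_distrib (f := fun _ : A => Real.exp 1 * (n:ℝ)), Finset.prod_mul_distrib (f := fun a => ((n:ℝ) / Real.exp 1) ^ c a), Finset.prod_const, Finset.prod_pow_eq_pow_sum, hsum]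
          rfl
  have hfac := factorial_lower n hn
  have horb' : (n.factorial : ℝ) ≤ (∏ a, ((c a).factorial : ℝ)) * ((typeClass A n Q).ncard : ℝ) := by
    exact_mod_cast horb
  have hpos : (0:ℝ) < ((n:ℝ) / Real.exp 1) ^ n := by positivity
  have : ((n:ℝ) / Real.exp 1) ^ n * 1 ≤ ((n:ℝ) / Real.exp 1) ^ n *
      (((typeClass A n Q).ncard : ℝ) * (∏ a, Q a ^ c a) * (Real.exp 1 * n) ^ Fintype.card A) := by
    calc _ ≤ (∏ a, ((c a).factorial : ℝ)) * ((typeClass A n Q).ncard : ℝ) := by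
          rw [mul_one]; exact hfac.trans horb'
      _ ≤ ((Real.exp 1 * n) ^ Fintype.card A * (((n:ℝ) / Real.exp 1) ^ n * ∏ a, Q a ^ c a)) * ((typeClass A n Q).ncard : ℝ) := by
          gcongr
      _ = _ := by ring
  exact le_of_mul_le_mul_left this hpos

lemma prod_P_le_one {A : Type*} [Fintype A] {n : ℕ} (P : A → ℝ) (hP : IsDist P) :
    ∑ x : Fin n → A, ∏ i, P (x i) = 1 := by
  classical
  have := (Finset.prod_univ_sum (fun _ : Fin n => (Finset.univ : Finset A)) (fun _ a => P a)).symm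
  simpa [hP.2] using this

lemma excess_le_one {A : Type*} [Fintype A] {n : ℕ} (P : A → ℝ) (hP : IsDist P)
    (E : (Fin n → A) → Prop) : ∑ x : Fin n → A, (∏ i, P (x i)) * ind (E x) ≤ 1 := by
  rw [← prod_P_le_one (n := n) P hP]
  refine Finset.sum_le_sum fun x _ => ?_
  have : 0 ≤ ∏ i, P (x i) := Finset.prod_nonneg fun i _ => hP.1 _
  nlinarith [ind_le_one (E x)]

lemma excess_nonneg {A : Type*} [Fintype A] {n : ℕ} (P : A → ℝ) (hP : IsDist P)
    (E : (Fin n → A) → Prop) : 0 ≤ ∑ x : Fin n → A, (∏ i, P (x i)) * ind (E x) :=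
  Finset.sum_nonneg fun x _ => mul_nonneg (Finset.prod_nonneg fun i _ => hP.1 _) (ind_nonneg _)

lemma rate_nonneg {n : ℕ} {p : ℝ} (h0 : 0 ≤ p) (h1 : p ≤ 1) : 0 ≤ -(n : ℝ)⁻¹ * Real.logb 2 p := by
  have : Real.logb 2 p ≤ 0 := Real.logb_nonpos (by norm_num) h0 h1
  have h2 : (0:ℝ) ≤ (n:ℝ)⁻¹ := by positivity
  nlinarith

lemma excess_eventually {A : Type*} [Fintype A] (P : A → ℝ) (hP : IsDist P)
    (E : ∀ n, (Fin n → A) → Prop) (Ec E1 : ℝ) (h1 : E1 < Ec)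
    (hE : Ec ≤ Filter.liminf (fun n : ℕ => -(n : ℝ)⁻¹ * Real.logb 2
      (∑ x : Fin n → A, (∏ i, P (x i)) * ind (E n x))) Filter.atTop) :
    ∀ᶠ n : ℕ in Filter.atTop, E1 < -(n : ℝ)⁻¹ * Real.logb 2
      (∑ x : Fin n → A, (∏ i, P (x i)) * ind (E n x)) := by
  refine Filter.eventually_lt_of_lt_liminf (lt_of_lt_of_le h1 hE) ?_
  refine Filter.isBoundedUnder_of ⟨0, fun n => ?_⟩
  exact rate_nonneg (excess_nonneg P hP _) (excess_le_one P hP _)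

lemma excess_fraction {A : Type*} [Fintype A] [DecidableEq A] (P : A → ℝ) (hP : IsDist P)
    (hPf : ∀ a, 0 < P a) (Q : A → ℝ) (hQf : ∀ a, 0 < Q a)
    (E : ∀ n, (Fin n → A) → Prop) (Ec : ℝ) (hKL : KL Q P < Ec)
    (hE : Ec ≤ Filter.liminf (fun n : ℕ => -(n : ℝ)⁻¹ * Real.logb 2
      (∑ x : Fin n → A, (∏ i, P (x i)) * ind (E n x))) Filter.atTop) :
    Filter.Tendsto (fun n : ℕ => ((typeClass A n Q ∩ {x | E n x}).ncard : ℝ) / ((typeClass A n Q).ncard : ℝ))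
      Filter.atTop (nhds 0) := by
  classical
  set c := (Ec - KL Q P) / 2 with hc
  have hc0 : 0 < c := by rw [hc]; linarith
  have hev := excess_eventually P hP E Ec (KL Q P + c) (by rw [hc]; linarith) hE
  have hlim : Filter.Tendsto (fun n : ℕ => (Real.exp 1) ^ Fintype.card A * ((n:ℝ) ^ Fintype.card A * ((2:ℝ) ^ (-c)) ^ n))
      Filter.atTop (nhds 0) := by
    have := tendsto_pow_const_mul_const_pow_of_abs_lt_one (Fintype.card A) (r := (2:ℝ)^(-c)) (by
      rw [abs_of_pos (by positivity)]
      exact Real.rpow_lt_one_of_one_lt_of_neg (by norm_num) (by linarith))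
    simpa using this.const_mul ((Real.exp 1) ^ Fintype.card A)
  refine tendsto_of_tendsto_of_tendsto_of_le_of_le' tendsto_const_nhds hlim
    (Filter.Eventually.of_forall fun n => by positivity) ?_
  filter_upwards [hev, Filter.eventually_gt_atTop 0] with n hn hn0
  have hn0' : (0:ℝ) < n := by exact_mod_cast hn0
  rcases (typeClass A n Q).eq_empty_or_nonempty with hT | ⟨x0, hx0⟩
  · rw [hT]; simp; positivity
  set pe := ∑ x : Fin n → A, (∏ i, P (x i)) * ind (E n x) with hpe
  have hpe0 : 0 ≤ pe := excess_nonneg P hP _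
  have hpele : pe ≤ (2:ℝ) ^ (-(n:ℝ) * (KL Q P + c)) := by
    rcases hpe0.eq_or_lt with h | h
    · rw [← h]; positivity
    · rw [← Real.logb_le_iff_le_rpow (by norm_num) h]
      have : (n:ℝ) * (KL Q P + c) < (n:ℝ) * (-(n:ℝ)⁻¹ * Real.logb 2 pe) := by gcongr
      have h3 : (n:ℝ) * (-(n:ℝ)⁻¹ * Real.logb 2 pe) = - Real.logb 2 pe := by field_simp
      linarith
  have hTpos : (0:ℝ) < (typeClass A n Q).ncard := by
    have : 0 < (typeClass A n Q).ncard := (Set.ncard_pos (Set.toFinite _)).mpr ⟨x0, hx0⟩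
    exact_mod_cast this
  have hP0 : 0 < ∏ i, P (x0 i) := Finset.prod_pos fun i _ => hPf _
  have hQ0 : 0 < ∏ i, Q (x0 i) := Finset.prod_pos fun i _ => hQf _
  have hB : ((typeClass A n Q ∩ {x | E n x}).ncard : ℝ) * ∏ i, P (x0 i) ≤ pe := by
    rw [hpe, Set.ncard_eq_toFinset_card', ← nsmul_eq_mul, ← Finset.sum_const]
    refine le_trans (Finset.sum_le_sum (g := fun x => (∏ i, P (x i)) * ind (E n x)) ?_)
      (Finset.sum_le_sum_of_subset_of_nonneg (Finset.subset_univ _) ?_)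
    · intro x hx
      rw [Set.mem_toFinset] at hx
      obtain ⟨hxT, hxE⟩ := hx
      have hxE : E n x := hxE
      obtain ⟨τ, rfl⟩ := typeClass_trans hn0 hx0 hxT
      rw [ind_pos' hxE, mul_one]
      exact le_of_eq (Equiv.prod_comp τ (fun i => P (x0 i))).symm
    · intro x _ _
      exact mul_nonneg (Finset.prod_nonneg fun i _ => hP.1 _) (ind_nonneg _)
  have hratio : (∏ i, Q (x0 i)) = (∏ i, P (x0 i)) * (2:ℝ) ^ ((n:ℝ) * KL Q P) := by
    have : (2:ℝ) ^ ((n:ℝ) * KL Q P) = ∏ i, (Q (x0 i) / P (x0 i)) := by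
      rw [prod_fiber x0 (fun a => Q a / P a)]
      unfold KL
      rw [Finset.mul_sum, Real.rpow_sum_of_pos (by norm_num)]
      refine Finset.prod_congr rfl fun a _ => ?_
      rw [← mul_assoc, ← typeClass_card_eq hn0 hx0 a, mul_comm, Real.rpow_mul (by norm_num),
        Real.rpow_logb (by norm_num) (by norm_num) (div_pos (hQf a) (hPf a)), Real.rpow_natCast]
    rw [this, Finset.prod_div_distrib]
    field_simp
  have htb := type_bound hn0 hQf hx0
  rw [div_le_iff₀ hTpos]
  have h2 : ((2:ℝ) ^ (-c)) ^ n = (2:ℝ) ^ (-(n:ℝ) * (KL Q P + c)) * (2:ℝ) ^ ((n:ℝ) * KL Q P) := by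
    rw [← Real.rpow_natCast, ← Real.rpow_mul (by norm_num), ← Real.rpow_add (by norm_num)]
    congr 1; ring
  have key : ((typeClass A n Q ∩ {x | E n x}).ncard : ℝ) * ∏ i, P (x0 i) ≤
      (Real.exp 1 ^ Fintype.card A * ((n:ℝ) ^ Fintype.card A * ((2:ℝ) ^ (-c)) ^ n) * ((typeClass A n Q).ncard : ℝ)) * ∏ i, P (x0 i) := by
    calc _ ≤ pe * 1 := by rw [mul_one]; exact hB
      _ ≤ (2:ℝ) ^ (-(n:ℝ) * (KL Q P + c)) * (((typeClass A n Q).ncard : ℝ) * (∏ i, Q (x0 i)) * (Real.exp 1 * n) ^ Fintype.card A) := by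
          gcongr
      _ = _ := by rw [hratio, h2, mul_pow]; ring
  exact le_of_mul_le_mul_right key hP0

/-- the fair coin -/
def coinMeas : MeasureTheory.Measure Bool := (PMF.uniformOfFintype Bool).toMeasure

instance coinMeas_prob : MeasureTheory.IsProbabilityMeasure coinMeas := by
  unfold coinMeas; infer_instance

lemma coinMeas_singleton (b : Bool) : coinMeas {b} = 2⁻¹ := by
  unfold coinMeas
  rw [PMF.toMeasure_apply_singleton _ _ (MeasurableSet.singleton b)]
  simp [PMF.uniformOfFintype_apply]

/-- the first `K` bits of a key stream -/
def prefixKey (K : ℕ) (u : ℕ → Bool) : Fin K → Bool := fun i => u i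

lemma prefixKey_measurable (K : ℕ) : Measurable (prefixKey K) := by
  unfold prefixKey
  fun_prop

lemma integral_prefix (K : ℕ) (g : (Fin K → Bool) → ℝ) :
    ∫ u, g (prefixKey K u) ∂(MeasureTheory.Measure.infinitePi fun _ : ℕ => coinMeas) =
      ((2:ℝ) ^ K)⁻¹ * ∑ p, g p := by
  set μ := MeasureTheory.Measure.infinitePi fun _ : ℕ => coinMeas
  have hg : Measurable g := measurable_of_finite g
  rw [← MeasureTheory.integral_map (φ := prefixKey K) (f := g) (prefixKey_measurable K).aemeasurable
    hg.aestronglyMeasurable]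
  have : MeasureTheory.IsProbabilityMeasure (μ.map (prefixKey K)) :=
    MeasureTheory.Measure.isProbabilityMeasure_map (prefixKey_measurable K).aemeasurable
  rw [MeasureTheory.integral_fintype (MeasureTheory.Integrable.of_finite), Finset.mul_sum]
  refine Finset.sum_congr rfl fun p _ => ?_
  rw [smul_eq_mul]
  congr 1
  unfold MeasureTheory.Measure.real
  rw [MeasureTheory.Measure.map_apply (prefixKey_measurable K) (MeasurableSet.singleton p)]
  have hset : prefixKey K ⁻¹' {p} = Set.pi (Finset.range K : Finset ℕ) (fun i => {extKey p i}) := by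
    ext u
    simp only [Set.mem_preimage, Set.mem_singleton_iff, Set.mem_pi, Finset.mem_coe, Finset.mem_range]
    constructor
    · rintro rfl i hi
      unfold extKey prefixKey
      simp [hi]
    · intro h
      funext i
      have := h i i.2
      simpa [extKey, prefixKey] using this
  rw [hset, MeasureTheory.Measure.infinitePi_pi _ (fun i _ => MeasurableSet.singleton _)]
  simp [coinMeas_singleton]

/-- pointwise convergence to zero for every key stream gives convergence of the averages over
finite keys, for suitable extensions of the finite keys -/
lemma key_extension (K : ℕ → ℕ) (b : ℕ → (ℕ → Bool) → ℝ) (hb0 : ∀ n u, 0 ≤ b n u)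
    (hb1 : ∀ n u, b n u ≤ 1) (hb : ∀ u, Filter.Tendsto (fun n => b n u) Filter.atTop (nhds 0)) :
    ∃ e : ∀ n, (Fin (K n) → Bool) → (ℕ → Bool),
      (∀ n p, prefixKey (K n) (e n p) = p) ∧
      Filter.Tendsto (fun n => ((2:ℝ) ^ K n)⁻¹ * ∑ p, b n (e n p)) Filter.atTop (nhds 0) := by
  have hex : ∀ n (p : Fin (K n) → Bool), ∃ u : ℕ → Bool, prefixKey (K n) u = p ∧
      ∀ u', prefixKey (K n) u' = p → b n u ≤ b n u' + 1 / ((n:ℝ) + 1) := by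
    intro n p
    have hpos : (0:ℝ) < 1 / ((n:ℝ) + 1) := by positivity
    set S : Set ℝ := (b n) '' {u | prefixKey (K n) u = p} with hS
    have hne : S.Nonempty := by
      refine ⟨b n (extKey p), extKey p, ?_, rfl⟩
      show prefixKey (K n) (extKey p) = p
      funext i
      simp [extKey, prefixKey]
    have hbd : BddBelow S := ⟨0, by rintro _ ⟨u, _, rfl⟩; exact hb0 n u⟩
    obtain ⟨_, ⟨u, hu, rfl⟩, hlt⟩ := exists_lt_of_csInf_lt hne (show sInf S < sInf S + 1 / ((n:ℝ) + 1) by linarith)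
    refine ⟨u, hu, fun u' hu' => ?_⟩
    have : sInf S ≤ b n u' := csInf_le hbd ⟨u', hu', rfl⟩
    linarith
  choose e he1 he2 using hex
  refine ⟨e, he1, ?_⟩
  have hlim : Filter.Tendsto (fun n => ∫ u, b n (e n (prefixKey (K n) u))
      ∂(MeasureTheory.Measure.infinitePi fun _ : ℕ => coinMeas)) Filter.atTop
      (nhds (∫ _, (0:ℝ) ∂(MeasureTheory.Measure.infinitePi fun _ : ℕ => coinMeas))) := by
    refine MeasureTheory.tendsto_integral_of_dominated_convergence (fun _ => (1:ℝ)) ?_ ?_ ?_ ?_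
    · intro n
      have : Measurable (fun p => b n (e n p)) := measurable_of_finite _
      exact (this.comp (prefixKey_measurable (K n))).aestronglyMeasurable
    · exact MeasureTheory.integrable_const _
    · intro n
      refine Filter.Eventually.of_forall fun u => ?_
      rw [Real.norm_of_nonneg (hb0 _ _)]
      exact hb1 _ _
    · refine Filter.Eventually.of_forall fun u => ?_
      have h1 : Filter.Tendsto (fun n : ℕ => b n u + 1 / ((n:ℝ) + 1)) Filter.atTop (nhds 0) := by
        simpa using (hb u).add tendsto_one_div_add_atTop_nhds_zero_nat
      exact tendsto_of_tendsto_of_tendsto_of_le_of_le tendsto_const_nhds h1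
        (fun n => hb0 _ _) (fun n => he2 n _ u rfl)
  rw [MeasureTheory.integral_zero] at hlim
  exact hlim.congr fun n => integral_prefix (K n) (fun p => b n (e n p))

/-- the success count of an eavesdropper, restricted to short keys, is bounded by `condExigProb` -/
lemma success_le {𝓧 𝓩 M : Type*} [Fintype 𝓧] [DecidableEq 𝓧] [Fintype 𝓩] [Fintype M]
    (dE : 𝓧 → 𝓩 → ℝ) (D : ℝ) (Q : 𝓧 → ℝ) {n : ℕ}
    (k : (Fin n → 𝓧) → ℕ) (f : (Fin n → 𝓧) → (ℕ → Bool) → M)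
    (hfdep : ∀ (x : Fin n → 𝓧) (u u' : ℕ → Bool), (∀ i < k x, u i = u' i) → f x u = f x u')
    (K : ℕ) (e : (Fin K → Bool) → (ℕ → Bool)) (he : ∀ p, prefixKey K (e p) = p)
    (hT : (typeClass 𝓧 n Q).Nonempty)
    (σ : M → (Fin n → 𝓩)) :
    ∑ x : Fin n → 𝓧, ∑ p : Fin K → Bool,
      ind ((x ∈ typeClass 𝓧 n Q ∧ k x ≤ K) ∧ seqDist dE x (σ (f x (e p))) ≤ D) ≤
    ((typeClass 𝓧 n Q).ncard : ℝ) * (2:ℝ) ^ K * condExigProb dE D Q k f := by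
  have hTpos : (0:ℝ) < (typeClass 𝓧 n Q).ncard := by
    have : 0 < (typeClass 𝓧 n Q).ncard := (Set.ncard_pos (Set.toFinite _)).mpr hT
    exact_mod_cast this
  set K' := Finset.univ.sup k with hK'
  have hstep : ∀ x, ∑ p : Fin K → Bool,
      ind ((x ∈ typeClass 𝓧 n Q ∧ k x ≤ K) ∧ seqDist dE x (σ (f x (e p))) ≤ D) ≤
      (2:ℝ)^K * ((2:ℝ)^K')⁻¹ * ∑ u : Fin K' → Bool,
        ind (x ∈ typeClass 𝓧 n Q ∧ seqDist dE x (σ (f x (extKey u))) ≤ D) := by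
    intro x
    by_cases hx : x ∈ typeClass 𝓧 n Q ∧ k x ≤ K
    · have hkK' : k x ≤ K' := Finset.le_sup (Finset.mem_univ x)
      set g : (ℕ → Bool) → ℝ := fun u => ind (x ∈ typeClass 𝓧 n Q ∧ seqDist dE x (σ (f x u)) ≤ D) with hg
      have hgdep : ∀ u u' : ℕ → Bool, (∀ i < k x, u i = u' i) → g u = g u' := by
        intro u u' h
        simp only [hg, hfdep x u u' h]
      have h1 := key_avg hx.2 hgdep
      have h2 := key_avg hkK' hgdep
      have h3 : ∀ p : Fin K → Bool, 
          ind ((x ∈ typeClass 𝓧 n Q ∧ k x ≤ K) ∧ seqDist dE x (σ (f x (e p))) ≤ D) = g (extKey p) := by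
        intro p
        rw [hgdep (extKey p) (e p)]
        · simp [hg, hx.1, hx.2]
        · intro i hi
          have hiK : i < K := lt_of_lt_of_le hi hx.2
          have := congrFun (he p) ⟨i, hiK⟩
          simp only [extKey, hiK, dif_pos]
          exact this.symm
      simp only [h3]
      rw [h1]
      change _ ≤ (2:ℝ)^K * ((2:ℝ)^K')⁻¹ * ∑ u : Fin K' → Bool, g (extKey u)
      rw [h2]
      apply le_of_eq
      field_simp
    · have : ∀ p : Fin K → Bool, 
          ind ((x ∈ typeClass 𝓧 n Q ∧ k x ≤ K) ∧ seqDist dE x (σ (f x (e p))) ≤ D) = 0 :=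
        fun p => ind_neg' fun h => hx h.1
      simp only [this, Finset.sum_const_zero]
      have : 0 ≤ ∑ u : Fin K' → Bool,
        ind (x ∈ typeClass 𝓧 n Q ∧ seqDist dE x (σ (f x (extKey u))) ≤ D) :=
        Finset.sum_nonneg fun _ _ => ind_nonneg _
      positivity
  have hsup : (((typeClass 𝓧 n Q).ncard : ℝ) * (2 : ℝ) ^ (K' : ℕ))⁻¹ *
      ∑ x : Fin n → 𝓧, ∑ u : Fin K' → Bool,
        ind (x ∈ typeClass 𝓧 n Q ∧ seqDist dE x (σ (f x (extKey u))) ≤ D) ≤ condExigProb dE D Q k f := by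
    classical
    unfold condExigProb
    exact le_ciSup (f := fun σ : M → (Fin n → 𝓩) =>
      (((typeClass 𝓧 n Q).ncard : ℝ) * (2 : ℝ) ^ (Finset.univ.sup k : ℕ))⁻¹ *
      ∑ x : Fin n → 𝓧, ∑ u : Fin (Finset.univ.sup k) → Bool,
        ind (x ∈ typeClass 𝓧 n Q ∧ seqDist dE x (σ (f x (extKey u))) ≤ D))
        (Set.finite_range _).bddAbove σ
  calc _ ≤ ∑ x : Fin n → 𝓧, (2:ℝ)^K * ((2:ℝ)^K')⁻¹ * ∑ u : Fin K' → Bool,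
        ind (x ∈ typeClass 𝓧 n Q ∧ seqDist dE x (σ (f x (extKey u))) ≤ D) :=
        Finset.sum_le_sum fun x _ => hstep x
    _ = ((typeClass 𝓧 n Q).ncard : ℝ) * (2:ℝ) ^ K * ((((typeClass 𝓧 n Q).ncard : ℝ) * (2 : ℝ) ^ (K' : ℕ))⁻¹ *
      ∑ x : Fin n → 𝓧, ∑ u : Fin K' → Bool,
        ind (x ∈ typeClass 𝓧 n Q ∧ seqDist dE x (σ (f x (extKey u))) ≤ D)) := by
        rw [← Finset.mul_sum]; field_simp
    _ ≤ _ := by gcongr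

/-- upper bound on `condExigProb` for a fixed key length code -/
lemma condExig_le {𝓧 𝓩 M : Type*} [Fintype 𝓧] [DecidableEq 𝓧] [Fintype 𝓩] [Nonempty 𝓩] [Fintype M]
    (dE : 𝓧 → 𝓩 → ℝ) (D : ℝ) (Q : 𝓧 → ℝ) {n : ℕ}
    (k : (Fin n → 𝓧) → ℕ) (f : (Fin n → 𝓧) → (ℕ → Bool) → M)
    (hfdep : ∀ (x : Fin n → 𝓧) (u u' : ℕ → Bool), (∀ i < k x, u i = u' i) → f x u = f x u')
    (K : ℕ) (hk : ∀ x ∈ typeClass 𝓧 n Q, k x = K)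
    (hT : (typeClass 𝓧 n Q).Nonempty) (C : ℝ)
    (hC : ∀ σ : M → (Fin n → 𝓩), ∑ x : Fin n → 𝓧, ∑ p : Fin K → Bool,
      ind (x ∈ typeClass 𝓧 n Q ∧ seqDist dE x (σ (f x (extKey p))) ≤ D) ≤
      ((typeClass 𝓧 n Q).ncard : ℝ) * (2:ℝ) ^ K * C) :
    condExigProb dE D Q k f ≤ C := by
  have hTpos : (0:ℝ) < (typeClass 𝓧 n Q).ncard := by
    have : 0 < (typeClass 𝓧 n Q).ncard := (Set.ncard_pos (Set.toFinite _)).mpr hT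
    exact_mod_cast this
  unfold condExigProb
  refine ciSup_le fun σ => ?_
  set K' := Finset.univ.sup k with hK'
  have hstep : ∀ x, ∑ u : Fin K' → Bool,
      ind (x ∈ typeClass 𝓧 n Q ∧ seqDist dE x (σ (f x (extKey u))) ≤ D) =
      (2:ℝ)^K' * ((2:ℝ)^K)⁻¹ * ∑ u : Fin K → Bool,
        ind (x ∈ typeClass 𝓧 n Q ∧ seqDist dE x (σ (f x (extKey u))) ≤ D) := by
    intro x
    by_cases hx : x ∈ typeClass 𝓧 n Q
    · have hkK' : K ≤ K' := by rw [← hk x hx]; exact Finset.le_sup (Finset.mem_univ x)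
      exact key_avg (g := fun u => ind (x ∈ typeClass 𝓧 n Q ∧ seqDist dE x (σ (f x u)) ≤ D)) hkK'
        (fun u u' h => by simp only [hfdep x u u' (by rw [hk x hx]; exact h)])
    · have h0 : ∀ (L : ℕ) (u : Fin L → Bool), 
        ind (x ∈ typeClass 𝓧 n Q ∧ seqDist dE x (σ (f x (extKey u))) ≤ D) = 0 :=
        fun L u => ind_neg' fun h => hx h.1
      simp [h0]
  simp only [hstep]
  rw [← Finset.mul_sum]
  have := hC σ
  calc _ ≤ (((typeClass 𝓧 n Q).ncard : ℝ) * (2 : ℝ) ^ K')⁻¹ * ((2:ℝ)^K' * ((2:ℝ)^K)⁻¹ * (((typeClass 𝓧 n Q).ncard : ℝ) * (2:ℝ) ^ K * C)) := by gcongr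
    _ = C := by field_simp

lemma condExig_lower {𝓧 𝓩 M : Type*} [Fintype 𝓧] [DecidableEq 𝓧] [Fintype 𝓩] [Fintype M]
    (dE : 𝓧 → 𝓩 → ℝ) (hzeroE : ∀ x, ∃ z, dE x z = 0) (D : ℝ) (hD : 0 ≤ D) (Q : 𝓧 → ℝ) {n : ℕ}
    (k : (Fin n → 𝓧) → ℕ) (f : (Fin n → 𝓧) → (ℕ → Bool) → M)
    (hfdep : ∀ (x : Fin n → 𝓧) (u u' : ℕ → Bool), (∀ i < k x, u i = u' i) → f x u = f x u')
    (hT : (typeClass 𝓧 n Q).Nonempty) :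
    ((Fintype.card 𝓧 : ℝ) ^ n)⁻¹ ≤ condExigProb dE D Q k f := by
  classical
  obtain ⟨x0, hx0⟩ := hT
  choose z hz using hzeroE
  have hTpos : (0:ℝ) < (typeClass 𝓧 n Q).ncard := by
    have : 0 < (typeClass 𝓧 n Q).ncard := (Set.ncard_pos (Set.toFinite _)).mpr ⟨x0, hx0⟩
    exact_mod_cast this
  have hTle : ((typeClass 𝓧 n Q).ncard : ℝ) ≤ (Fintype.card 𝓧 : ℝ) ^ n := by
    have := Set.ncard_le_card (typeClass 𝓧 n Q)
    rw [Nat.card_eq_fintype_card] at this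
    simp only [Fintype.card_fun, Fintype.card_fin] at this
    exact_mod_cast this
  have h := success_le dE D Q k f hfdep (k x0) extKey (fun p => by funext i; simp [extKey, prefixKey]) ⟨x0, hx0⟩ (fun _ i => z (x0 i))
  have h1 : (2:ℝ) ^ (k x0) ≤ ∑ x : Fin n → 𝓧, ∑ p : Fin (k x0) → Bool,
      ind ((x ∈ typeClass 𝓧 n Q ∧ k x ≤ k x0) ∧ seqDist dE x (fun i => z (x0 i)) ≤ D) := by
    refine le_trans ?_ (Finset.single_le_sum (f := fun x => ∑ p : Fin (k x0) → Bool,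
      ind ((x ∈ typeClass 𝓧 n Q ∧ k x ≤ k x0) ∧ seqDist dE x (fun i => z (x0 i)) ≤ D))
      (fun x _ => Finset.sum_nonneg fun _ _ => ind_nonneg _) (Finset.mem_univ x0))
    have : (x0 ∈ typeClass 𝓧 n Q ∧ k x0 ≤ k x0) ∧ seqDist dE x0 (fun i => z (x0 i)) ≤ D := by
      refine ⟨⟨hx0, le_rfl⟩, ?_⟩
      simp [seqDist, hz, hD]
    simp only [ind_pos' this]
    simp
  have h2 := h1.trans h
  have h3 : 1 ≤ ((typeClass 𝓧 n Q).ncard : ℝ) * condExigProb dE D Q k f := by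
    have hp : (0:ℝ) < 2 ^ (k x0) := by positivity
    have : (2:ℝ) ^ (k x0) * 1 ≤ (2:ℝ) ^ (k x0) * (((typeClass 𝓧 n Q).ncard : ℝ) * condExigProb dE D Q k f) := by
      linarith
    exact le_of_mul_le_mul_left this hp
  have h4 : (((typeClass 𝓧 n Q).ncard : ℝ))⁻¹ ≤ condExigProb dE D Q k f := by
    rw [inv_le_iff_one_le_mul₀ hTpos]; linarith
  refine le_trans ?_ h4
  gcongr

lemma condExig_le_one {𝓧 𝓩 M : Type*} [Fintype 𝓧] [DecidableEq 𝓧] [Fintype 𝓩] [Nonempty 𝓩] [Fintype M]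
    (dE : 𝓧 → 𝓩 → ℝ) (D : ℝ) (Q : 𝓧 → ℝ) {n : ℕ}
    (k : (Fin n → 𝓧) → ℕ) (f : (Fin n → 𝓧) → (ℕ → Bool) → M)
    (hT : (typeClass 𝓧 n Q).Nonempty) :
    condExigProb dE D Q k f ≤ 1 := by
  classical
  have hTpos : (0:ℝ) < (typeClass 𝓧 n Q).ncard := by
    have : 0 < (typeClass 𝓧 n Q).ncard := (Set.ncard_pos (Set.toFinite _)).mpr hT
    exact_mod_cast this
  unfold condExigProb
  refine ciSup_le fun σ => ?_
  rw [inv_mul_le_iff₀ (by positivity), mul_one]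
  calc _ ≤ ∑ x : Fin n → 𝓧, ∑ u : Fin (Finset.univ.sup k) → Bool, ind (x ∈ typeClass 𝓧 n Q) :=
        Finset.sum_le_sum fun x _ => Finset.sum_le_sum fun u _ => ind_mono fun h => h.1
    _ = _ := by
      simp only [Finset.sum_const, Finset.card_univ, Fintype.card_fun, Fintype.card_fin, Fintype.card_bool, nsmul_eq_mul]
      rw [← Finset.mul_sum, mul_comm]
      congr 1
      · unfold ind
        rw [Set.ncard_eq_toFinset_card']
        simp [Set.toFinset]
      · push_cast; rfl

lemma block_code {𝓧 𝓦 𝓩 Y : Type*} [Fintype 𝓧] [DecidableEq 𝓧] [Fintype 𝓩]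
    [Nonempty 𝓦] [Fintype Y]
    (dL : 𝓧 → 𝓦 → ℝ) (dE : 𝓧 → 𝓩 → ℝ) (Dc : ℝ) (Q : 𝓧 → ℝ) {n : ℕ} (hn : 0 < n)
    (k : (Fin n → 𝓧) → ℕ) (f : (Fin n → 𝓧) → (ℕ → Bool) → Y)
    (φ : Y → (ℕ → Bool) → (Fin n → 𝓦))
    (hfdep : ∀ (x : Fin n → 𝓧) (u u' : ℕ → Bool), (∀ i < k x, u i = u' i) → f x u = f x u')
    (K : ℕ) (e : (Fin K → Bool) → (ℕ → Bool)) (he : ∀ p, prefixKey K (e p) = p)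
    (hT : (typeClass 𝓧 n Q).Nonempty)
    (hbad : 4 * {q : (Fin n → 𝓧) × (Fin K → Bool) | q.1 ∈ typeClass 𝓧 n Q ∧
      ¬ (k q.1 ≤ K ∧ seqDist dL q.1 (φ (f q.1 (e q.2)) (e q.2)) < Dc)}.ncard
        ≤ (typeClass 𝓧 n Q).ncard * 2 ^ K)
    (N M : ℕ) (hN : (Fintype.card 𝓧) ^ n * 2 ^ K < 2 ^ N) (hM : 4 * (Fintype.card 𝓧) ^ n ≤ M) :
    ∃ (fs : (Fin n → 𝓧) → (Fin K → Bool) → Fin N × Fin M)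
      (φs : Fin N × Fin M → (Fin K → Bool) → (Fin n → 𝓦)),
      (∀ x ∈ typeClass 𝓧 n Q, ∀ p, seqDist dL x (φs (fs x p) p) < Dc) ∧
      (∀ (D : ℝ) (σ : Fin N × Fin M → (Fin n → 𝓩)),
        ∑ x : Fin n → 𝓧, ∑ p : Fin K → Bool,
          ind (x ∈ typeClass 𝓧 n Q ∧ seqDist dE x (σ (fs x p)) ≤ D) ≤
        N * (((typeClass 𝓧 n Q).ncard : ℝ) * (2:ℝ) ^ K * condExigProb dE D Q k f)) := by
  classical
  set T := typeClass 𝓧 n Q with hTdef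
  have hTcard : Fintype.card T = T.ncard := by
    rw [← Nat.card_coe_set_eq, Nat.card_eq_fintype_card]
  have hTle : T.ncard ≤ (Fintype.card 𝓧) ^ n := by
    have := Set.ncard_le_card T
    rw [Nat.card_eq_fintype_card] at this
    simpa using this
  have hTpos : 0 < T.ncard := (Set.ncard_pos (Set.toFinite _)).mpr hT
  have hMpos : 0 < M := by omega
  -- hashing
  obtain ⟨h, hh⟩ := hash_exists (T := T) (K := Fin K → Bool) M hMpos (fun x p => f x.1 (e p))
  set Col : Finset (T × (Fin K → Bool)) := (Finset.univ.filter fun q : T × (Fin K → Bool) =>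
        ∃ x' : T, f x'.1 (e q.2) ≠ f q.1.1 (e q.2) ∧ h (f x'.1 (e q.2)) = h (f q.1.1 (e q.2))) with hCol
  set Bad : Finset (T × (Fin K → Bool)) := (Finset.univ.filter fun q : T × (Fin K → Bool) =>
      ¬ (k q.1.1 ≤ K ∧ seqDist dL q.1.1 (φ (f q.1.1 (e q.2)) (e q.2)) < Dc)) with hBad
  set A : Finset (T × (Fin K → Bool)) := (Bad ∪ Col)ᶜ with hA
  have hΩ : Fintype.card (T × (Fin K → Bool)) = T.ncard * 2 ^ K := by
    simp [Fintype.card_prod, hTcard]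
  have hColc : 4 * Col.card ≤ T.ncard * 2 ^ K := by
    have h1 : Col.card * M ≤ T.ncard * T.ncard * 2 ^ K := by
      simpa [hTcard] using hh
    have h2 : Col.card * (4 * T.ncard) ≤ Col.card * M := Nat.mul_le_mul_left _ (by omega)
    have h3 : T.ncard * (4 * Col.card) ≤ T.ncard * (T.ncard * 2 ^ K) := by nlinarith
    exact Nat.le_of_mul_le_mul_left h3 hTpos
  have hBadc : 4 * Bad.card ≤ T.ncard * 2 ^ K := by
    refine le_trans (Nat.mul_le_mul_left 4 ?_) hbad
    rw [Set.ncard_eq_toFinset_card']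
    refine Finset.card_le_card_of_injOn (fun q => (q.1.1, q.2)) ?_ ?_
    · intro q hq
      simp only [hBad, Finset.coe_filter, Finset.mem_univ, true_and] at hq
      simp only [Set.coe_toFinset]
      exact ⟨q.1.2, hq⟩
    · rintro ⟨⟨a, ha⟩, b⟩ _ ⟨⟨c, hc⟩, d⟩ _ heq
      simp only [Prod.mk.injEq] at heq
      obtain ⟨rfl, rfl⟩ := heq
      rfl
  have hAc : Fintype.card (T × (Fin K → Bool)) ≤ 2 * A.card := by
    rw [hA, Finset.card_compl]
    have := Finset.card_union_le Bad Col
    rw [hΩ]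
    omega
  -- group action
  let act : (Equiv.Perm (Fin n) × (Fin K → Bool)) → (T × (Fin K → Bool)) ≃ (T × (Fin K → Bool)) :=
    fun g =>
      { toFun := fun q => (⟨q.1.1 ∘ g.1, comp_mem_typeClass q.1.2 g.1⟩, fun i => xor (q.2 i) (g.2 i))
        invFun := fun q => (⟨q.1.1 ∘ (g.1⁻¹ : Equiv.Perm (Fin n)), comp_mem_typeClass q.1.2 _⟩, fun i => xor (q.2 i) (g.2 i))
        left_inv := by
          rintro ⟨⟨x, hx⟩, p⟩
          simp only [Prod.mk.injEq, Subtype.mk.injEq]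
          refine ⟨?_, ?_⟩
          · funext i; simp
          · funext i; simp
        right_inv := by
          rintro ⟨⟨x, hx⟩, p⟩
          simp only [Prod.mk.injEq, Subtype.mk.injEq]
          refine ⟨?_, ?_⟩
          · funext i; simp
          · funext i; simp }
  have hact : ∀ c c' : T × (Fin K → Bool), ∃ E : (Equiv.Perm (Fin n) × (Fin K → Bool)) ≃ (Equiv.Perm (Fin n) × (Fin K → Bool)),
      ∀ i, act i c' = act (E i) c := by
    rintro ⟨⟨x, hx⟩, p⟩ ⟨⟨x', hx'⟩, p'⟩
    obtain ⟨τ, hτ⟩ := typeClass_trans hn hx hx'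
    have hinv : Function.Involutive (fun v : Fin K → Bool => fun i => xor (xor (v i) (p i)) (p' i)) := by
      intro v; funext i
      show xor (xor (xor (xor (v i) (p i)) (p' i)) (p i)) (p' i) = v i
      cases v i <;> cases p i <;> cases p' i <;> rfl
    refine ⟨Equiv.prodCongr (Equiv.mulLeft τ) hinv.toPerm, ?_⟩
    rintro ⟨π, v⟩
    simp only [act, Equiv.coe_fn_mk, Equiv.prodCongr_apply, Prod.map, Prod.mk.injEq, Subtype.mk.injEq]
    refine ⟨?_, ?_⟩
    · rw [hτ]; rfl
    · funext i
      show xor (p' i) (v i) = xor (p i) (xor (xor (v i) (p i)) (p' i))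
      cases v i <;> cases p i <;> cases p' i <;> rfl
  obtain ⟨g, hg⟩ := cover_aux act hact A hAc N Finset.univ (by
    rw [Finset.card_univ, hΩ]
    exact lt_of_le_of_lt (Nat.mul_le_mul_right _ hTle) hN)
  choose j hj using fun ω => hg ω (Finset.mem_univ ω)
  have hmem : ∀ q ∈ A, (k q.1.1 ≤ K ∧ seqDist dL q.1.1 (φ (f q.1.1 (e q.2)) (e q.2)) < Dc) ∧
      ∀ x' : T, h (f x'.1 (e q.2)) = h (f q.1.1 (e q.2)) → f x'.1 (e q.2) = f q.1.1 (e q.2) := by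
    intro q hq
    simp only [hA, Finset.mem_compl, Finset.mem_union, not_or, hBad, hCol, Finset.mem_filter,
      Finset.mem_univ, true_and, not_not] at hq
    refine ⟨hq.1, fun x' hx' => ?_⟩
    by_contra hne
    exact hq.2 ⟨x', hne, hx'⟩
  obtain ⟨x0, hx0⟩ := hT
  have hNpos : 0 < N := by
    rcases Nat.eq_zero_or_pos N with h0 | h0
    · subst h0
      exact (j (⟨x0, hx0⟩, fun _ => false)).elim0
    · exact h0
  let fs : (Fin n → 𝓧) → (Fin K → Bool) → Fin N × Fin M := fun x p =>
    if hx : x ∈ T then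
      (j (⟨x, hx⟩, p), h (f (act (g (j (⟨x, hx⟩, p))) (⟨x, hx⟩, p)).1.1 (e (act (g (j (⟨x, hx⟩, p))) (⟨x, hx⟩, p)).2)))
    else (⟨0, hNpos⟩, ⟨0, hMpos⟩)
  let xk : Fin N → (Fin K → Bool) → (Fin K → Bool) := fun j p i => xor (p i) ((g j).2 i)
  let φs : Fin N × Fin M → (Fin K → Bool) → (Fin n → 𝓦) := fun c p =>
    if hex : ∃ x' : T, h (f x'.1 (e (xk c.1 p))) = c.2 then
      φ (f hex.choose.1 (e (xk c.1 p))) (e (xk c.1 p)) ∘ ((g c.1).1⁻¹ : Equiv.Perm (Fin n))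
    else fun _ => Classical.arbitrary 𝓦
  refine ⟨fs, φs, ?_, ?_⟩
  · intro x hx p
    set q : T × (Fin K → Bool) := (⟨x, hx⟩, p) with hq
    obtain ⟨⟨h1, h2⟩, h3⟩ := hmem _ (hj q)
    have hfs : fs x p = (j q, h (f (act (g (j q)) q).1.1 (e (act (g (j q)) q).2))) := by
      simp only [fs, dif_pos hx, hq]
    have hxk : xk (j q) p = (act (g (j q)) q).2 := rfl
    have hex : ∃ x' : T, h (f x'.1 (e (xk (fs x p).1 p))) = (fs x p).2 := by
      refine ⟨(act (g (j q)) q).1, ?_⟩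
      rw [hfs]
      rfl
    have hφ : φs (fs x p) p = φ (f hex.choose.1 (e (xk (fs x p).1 p))) (e (xk (fs x p).1 p)) ∘ ((g (fs x p).1).1⁻¹ : Equiv.Perm (Fin n)) := by
      simp only [φs, dif_pos hex]
    have hsp := hex.choose_spec
    rw [hφ]
    generalize hex.choose = x' at hsp ⊢
    rw [hfs] at hsp ⊢
    simp only [hxk] at hsp ⊢
    rw [h3 x' hsp]
    rw [← seqDist_comp dL x _ (g (j q)).1]
    have hcomp : ∀ W : Fin n → 𝓦, (W ∘ ((g (j q)).1⁻¹ : Equiv.Perm (Fin n))) ∘ (g (j q)).1 = W := by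
      intro W; funext i; simp
    rw [hcomp]
    exact h2
  · intro D σ
    have hterm : ∀ jj : Fin N, 
        ∑ q : T × (Fin K → Bool), ind (act (g jj) q ∈ A ∧
          seqDist dE q.1.1 (σ (jj, h (f (act (g jj) q).1.1 (e (act (g jj) q).2)))) ≤ D) ≤
        ((T.ncard : ℝ) * (2:ℝ) ^ K * condExigProb dE D Q k f) := by
      intro jj
      refine le_trans ?_ (success_le dE D Q k f hfdep K e he ⟨x0, hx0⟩
        (fun y => σ (jj, h y) ∘ (g jj).1))
      have h1 : ∀ q : T × (Fin K → Bool), ind (act (g jj) q ∈ A ∧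
          seqDist dE q.1.1 (σ (jj, h (f (act (g jj) q).1.1 (e (act (g jj) q).2)))) ≤ D) =
          (fun q' : T × (Fin K → Bool) => ind (q' ∈ A ∧ seqDist dE q'.1.1
            (σ (jj, h (f q'.1.1 (e q'.2))) ∘ (g jj).1) ≤ D)) (act (g jj) q) := by
        intro q
        simp only
        have : seqDist dE (act (g jj) q).1.1 (σ (jj, h (f (act (g jj) q).1.1 (e (act (g jj) q).2))) ∘ (g jj).1) =
            seqDist dE q.1.1 (σ (jj, h (f (act (g jj) q).1.1 (e (act (g jj) q).2)))) :=
          seqDist_comp dE q.1.1 _ (g jj).1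
        rw [this]
      rw [Finset.sum_congr rfl (fun q _ => h1 q), Equiv.sum_comp (act (g jj))
        (fun q' : T × (Fin K → Bool) => ind (q' ∈ A ∧ seqDist dE q'.1.1
            (σ (jj, h (f q'.1.1 (e q'.2))) ∘ (g jj).1) ≤ D)), Fintype.sum_prod_type]
      have hsub : ∀ F : (Fin n → 𝓧) → ℝ, (∀ x, 0 ≤ F x) → ∑ x : T, F x.1 ≤ ∑ x, F x := by
        intro F hF
        rw [← Finset.sum_image (f := F) (s := (Finset.univ : Finset T)) (g := Subtype.val) (by
          intro a _ b _ hab; exact Subtype.ext hab)]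
        exact Finset.sum_le_sum_of_subset_of_nonneg (Finset.subset_univ _) (fun x _ _ => hF x)
      refine le_trans ?_ (hsub _ fun x => Finset.sum_nonneg fun p _ => ind_nonneg _)
      refine Finset.sum_le_sum fun x _ => Finset.sum_le_sum fun p _ => ind_mono ?_
      rintro ⟨ha, hb⟩
      exact ⟨⟨x.2, (hmem _ ha).1.1⟩, hb⟩
    have hpt : ∀ (x : Fin n → 𝓧), x ∉ Set.range (Subtype.val : T → _) → 
        ∑ p : Fin K → Bool, ind (x ∈ T ∧ seqDist dE x (σ (fs x p)) ≤ D) = 0 := by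
      intro x hx
      refine Finset.sum_eq_zero fun p _ => ind_neg' fun hh => hx ⟨⟨x, hh.1⟩, rfl⟩
    have hsum : ∑ x : Fin n → 𝓧, ∑ p : Fin K → Bool,
          ind (x ∈ T ∧ seqDist dE x (σ (fs x p)) ≤ D) =
        ∑ x : T, ∑ p : Fin K → Bool, ind (x.1 ∈ T ∧ seqDist dE x.1 (σ (fs x.1 p)) ≤ D) := by
      rw [← Finset.sum_image (f := fun x => ∑ p : Fin K → Bool, ind (x ∈ T ∧ seqDist dE x (σ (fs x p)) ≤ D))
        (s := (Finset.univ : Finset T)) (g := Subtype.val) (by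
          intro a _ b _ hab; exact Subtype.ext hab)]
      symm
      refine Finset.sum_subset (Finset.subset_univ _) fun x _ hx => hpt x ?_
      simpa using hx
    rw [hsum, ← Fintype.sum_prod_type' (f := fun (x : T) (p : Fin K → Bool) => ind (x.1 ∈ T ∧ seqDist dE x.1 (σ (fs x.1 p)) ≤ D))]
    calc _ ≤ ∑ q : T × (Fin K → Bool), ∑ jj : Fin N, ind (act (g jj) q ∈ A ∧
          seqDist dE q.1.1 (σ (jj, h (f (act (g jj) q).1.1 (e (act (g jj) q).2)))) ≤ D) := by
          refine Finset.sum_le_sum fun q _ => ?_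
          refine le_trans ?_ (Finset.single_le_sum (f := fun jj => ind (act (g jj) q ∈ A ∧
            seqDist dE q.1.1 (σ (jj, h (f (act (g jj) q).1.1 (e (act (g jj) q).2)))) ≤ D))
            (fun _ _ => ind_nonneg _) (Finset.mem_univ (j q)))
          refine ind_mono ?_
          rintro ⟨_, hb⟩
          refine ⟨hj q, ?_⟩
          have hfs : fs q.1.1 q.2 = (j q, h (f (act (g (j q)) q).1.1 (e (act (g (j q)) q).2))) := by
            simp only [fs, dif_pos q.1.2]
          rw [hfs] at hb
          exact hb
      _ = ∑ jj : Fin N, ∑ q : T × (Fin K → Bool), ind (act (g jj) q ∈ A ∧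
          seqDist dE q.1.1 (σ (jj, h (f (act (g jj) q).1.1 (e (act (g jj) q).2)))) ≤ D) := Finset.sum_comm
      _ ≤ ∑ jj : Fin N, ((T.ncard : ℝ) * (2:ℝ) ^ K * condExigProb dE D Q k f) :=
          Finset.sum_le_sum fun jj _ => hterm jj
      _ = _ := by simp

lemma xdag_exists {𝓧 𝓦 : Type*} [Fintype 𝓧] [DecidableEq 𝓧] [Nontrivial 𝓧] [Fintype 𝓦] [Nonempty 𝓦]
    (P : 𝓧 → ℝ) (hP : IsDist P) (hPf : ∀ a, 0 < P a) (dL : 𝓧 → 𝓦 → ℝ)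
    (Q : 𝓧 → ℝ) (hQf : ∀ a, 0 < Q a) (Dc : ℝ) (Pm : ℝ) (hPm : 0 < Pm) (hPmle : ∀ a, Pm ≤ P a)
    {n : ℕ} (hn : 0 < n) (x0 : Fin n → 𝓧) (w0 : Fin n → 𝓦) (h0 : Dc ≤ seqDist dL x0 w0) :
    ∃ (x : Fin n → 𝓧) (w : Fin n → 𝓦), x ∉ typeClass 𝓧 n Q ∧ Dc ≤ seqDist dL x w ∧
      ∏ i, P (x i) ≤ (∏ i, P (x0 i)) / Pm := by
  classical
  have hP1 : ∀ a, P a ≤ 1 := fun a => by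
    rw [← hP.2]; exact Finset.single_le_sum (fun b _ => hP.1 b) (Finset.mem_univ a)
  have hprod : 0 < ∏ i, P (x0 i) := Finset.prod_pos fun i _ => hPf _
  by_cases hx0 : x0 ∈ typeClass 𝓧 n Q
  swap
  · refine ⟨x0, w0, hx0, h0, ?_⟩
    rw [le_div_iff₀ hPm]
    have : Pm ≤ 1 := (hPmle (x0 ⟨0, hn⟩)).trans (hP1 _)
    nlinarith
  have hmax : ∀ a, ∃ w, ∀ w', dL a w' ≤ dL a w := fun a => Finite.exists_max (dL a)
  choose wm hwm using hmax
  obtain ⟨a, ha⟩ := Finite.exists_max (fun a => dL a (wm a))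
  obtain ⟨b, hb⟩ := exists_ne a
  have hcard := typeClass_card_eq hn hx0 b
  have hpos : 0 < Fintype.card {i // x0 i = b} := by
    have : (0:ℝ) < Fintype.card {i // x0 i = b} := by
      rw [hcard]; have := hQf b; positivity
    exact_mod_cast this
  obtain ⟨⟨i, hi⟩⟩ := Fintype.card_pos_iff.mp hpos
  refine ⟨Function.update x0 i a, fun j => wm (Function.update x0 i a j), ?_, ?_, ?_⟩
  · intro hx
    have hc2 := typeClass_card_eq hn hx b
    rw [← hcard] at hc2
    have hc3 : Fintype.card {j // Function.update x0 i a j = b} = Fintype.card {j // x0 j = b} := by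
      exact_mod_cast hc2
    rw [Fintype.card_subtype, Fintype.card_subtype] at hc3
    have hlt : (Finset.univ.filter fun j => Function.update x0 i a j = b) ⊂
        (Finset.univ.filter fun j => x0 j = b) := by
      rw [Finset.ssubset_iff_of_subset]
      · refine ⟨i, by simp [hi], ?_⟩
        simp [hb.symm]
      · intro j hj
        simp only [Finset.mem_filter, Finset.mem_univ, true_and] at hj ⊢
        by_cases hji : j = i
        · subst hji; exact hi
        · rwa [Function.update_of_ne hji] at hj
    have := Finset.card_lt_card hlt
    omega
  · refine h0.trans ?_
    unfold seqDist
    refine mul_le_mul_of_nonneg_left (Finset.sum_le_sum fun j _ => ?_) (by positivity)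
    by_cases hji : j = i
    · subst hji
      simp only [Function.update_self]
      exact (hwm _ _).trans (ha _)
    · simp only [Function.update_of_ne hji]
      exact hwm _ _
  · have h1 : ∏ j, P (Function.update x0 i a j) = P a * ∏ j ∈ Finset.univ \ {i}, P (x0 j) := by
      have : (fun j => P (Function.update x0 i a j)) = Function.update (fun j => P (x0 j)) i (P a) := by
        funext j
        by_cases hji : j = i
        · subst hji; simp
        · simp [Function.update_of_ne hji]
      rw [this, Finset.prod_update_of_mem (Finset.mem_univ i)]
    have h2 : ∏ j, P (x0 j) = P (x0 i) * ∏ j ∈ Finset.univ \ {i}, P (x0 j) := by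
      rw [← Finset.prod_update_of_mem (Finset.mem_univ i)]
      simp
    rw [h1, le_div_iff₀ hPm, h2]
    have h3 : 0 < ∏ j ∈ Finset.univ \ {i}, P (x0 j) := Finset.prod_pos fun i _ => hPf _
    have h4 := hP1 a
    have h5 := hPmle (x0 i)
    have h6 := hPf a
    have : P a * Pm ≤ P (x0 i) := by nlinarith
    nlinarith

lemma le_liminf_aux (s : ℕ → ℝ) (Ec C : ℝ)
    (h : ∀ E1 < Ec, ∀ᶠ n in Filter.atTop, E1 ≤ s n) (hC : ∀ᶠ n in Filter.atTop, s n ≤ C) :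
    Ec ≤ Filter.liminf s Filter.atTop := by
  refine le_of_forall_lt fun E1 hE1 => ?_
  obtain ⟨E2, h1, h2⟩ := exists_between hE1
  refine lt_of_lt_of_le h1 (Filter.le_liminf_of_le ?_ (h E2 h2))
  exact Filter.IsBoundedUnder.isCoboundedUnder_ge ⟨C, by simpa using hC⟩

lemma tendsto_log_lin (C : ℝ) (hC : 0 < C) :
    Filter.Tendsto (fun n : ℕ => (n:ℝ)⁻¹ * Real.logb 2 (C * n)) Filter.atTop (nhds 0) := by
  have h1 : Filter.Tendsto (fun n : ℕ => Real.log (n:ℝ) / n) Filter.atTop (nhds 0) := by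
    have := Real.isLittleO_log_id_atTop.tendsto_div_nhds_zero
    exact this.comp tendsto_natCast_atTop_atTop
  have h2 : Filter.Tendsto (fun n : ℕ => (n:ℝ)⁻¹) Filter.atTop (nhds 0) :=
    tendsto_inv_atTop_nhds_zero_nat
  have h3 := ((h2.mul_const (Real.log C)).add h1).mul_const (Real.log 2)⁻¹
  simp only [zero_mul, add_zero] at h3
  refine h3.congr' ?_
  filter_upwards [Filter.eventually_gt_atTop 0] with n hn
  have hn' : (n:ℝ) ≠ 0 := by positivity
  rw [Real.logb, Real.log_mul hC.ne' hn']
  field_simp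

lemma excess_pos_lt {A : Type*} [Fintype A] (P : A → ℝ) (hP : IsDist P)
    (E : ∀ n, (Fin n → A) → Prop) (Ec : ℝ) (h1 : 0 < Ec)
    (hE : Ec ≤ Filter.liminf (fun n : ℕ => -(n : ℝ)⁻¹ * Real.logb 2
      (∑ x : Fin n → A, (∏ i, P (x i)) * ind (E n x))) Filter.atTop) :
    ∀ᶠ n : ℕ in Filter.atTop, 0 < ∑ x : Fin n → A, (∏ i, P (x i)) * ind (E n x) ∧
      ∑ x : Fin n → A, (∏ i, P (x i)) * ind (E n x) < 1 := by
  filter_upwards [excess_eventually P hP E Ec 0 h1 hE] with n hn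
  refine ⟨lt_of_le_of_ne (excess_nonneg P hP _) ?_, lt_of_le_of_ne (excess_le_one P hP _) ?_⟩
  · intro h; rw [← h] at hn; simp at hn
  · intro h; rw [h] at hn; simp at hn

lemma exists_of_excess_pos {A : Type*} [Fintype A] (P : A → ℝ) (hP : IsDist P) {n : ℕ}
    (E : (Fin n → A) → Prop) (h : 0 < ∑ x : Fin n → A, (∏ i, P (x i)) * ind (E x)) :
    ∃ x, E x ∧ ∏ i, P (x i) ≤ ∑ x : Fin n → A, (∏ i, P (x i)) * ind (E x) := by
  obtain ⟨x, _, hx⟩ := Finset.exists_lt_of_sum_lt (s := Finset.univ) (f := fun _ : Fin n → A => (0:ℝ))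
    (g := fun x : Fin n → A => (∏ i, P (x i)) * ind (E x)) (by simpa using h)
  have hEx : E x := by
    by_contra hne
    rw [ind_neg' hne] at hx; simp at hx
  refine ⟨x, hEx, ?_⟩
  have := Finset.single_le_sum (f := fun x : Fin n → A => (∏ i, P (x i)) * ind (E x))
    (fun y _ => mul_nonneg (Finset.prod_nonneg fun i _ => hP.1 _) (ind_nonneg _)) (Finset.mem_univ x)
  simpa [ind_pos' hEx] using this

lemma bad_eventually {𝓧 : Type*} [Fintype 𝓧] [DecidableEq 𝓧] (Q : 𝓧 → ℝ)
    (k : ∀ n : ℕ, (Fin n → 𝓧) → ℕ) (Dist : ∀ n, (Fin n → 𝓧) → (ℕ → Bool) → Prop) (K : ℕ → ℕ)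
    (e : ∀ n, (Fin (K n) → Bool) → (ℕ → Bool))
    (hA : ∀ᶠ n in Filter.atTop, (typeClass 𝓧 n Q).Nonempty →
      ((typeClass 𝓧 n Q ∩ {x | K n < k n x}).ncard : ℝ) / ((typeClass 𝓧 n Q).ncard : ℝ) ≤ 1 / 8)
    (hB : Filter.Tendsto (fun n => ((2:ℝ) ^ K n)⁻¹ * ∑ p, 
      ((typeClass 𝓧 n Q ∩ {x | ¬ Dist n x (e n p)}).ncard : ℝ) / ((typeClass 𝓧 n Q).ncard : ℝ)) Filter.atTop (nhds 0)) :
    ∀ᶠ n in Filter.atTop, (typeClass 𝓧 n Q).Nonempty →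
      4 * {q : (Fin n → 𝓧) × (Fin (K n) → Bool) | q.1 ∈ typeClass 𝓧 n Q ∧
        ¬ (k n q.1 ≤ K n ∧ Dist n q.1 (e n q.2))}.ncard
        ≤ (typeClass 𝓧 n Q).ncard * 2 ^ K n := by
  filter_upwards [hA, hB.eventually_lt_const (show (0:ℝ) < 1/8 by norm_num)] with n h1 h2 hT
  have hTpos : (0:ℝ) < (typeClass 𝓧 n Q).ncard := by
    have : 0 < (typeClass 𝓧 n Q).ncard := (Set.ncard_pos (Set.toFinite _)).mpr hT
    exact_mod_cast this
  have h1 := h1 hT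
  rw [div_le_iff₀ hTpos] at h1
  rw [← Finset.sum_div, inv_mul_lt_iff₀ (by positivity), div_lt_iff₀ hTpos] at h2
  set T := typeClass 𝓧 n Q
  have hsub : {q : (Fin n → 𝓧) × (Fin (K n) → Bool) | q.1 ∈ T ∧
        ¬ (k n q.1 ≤ K n ∧ Dist n q.1 (e n q.2))} ⊆
      ⋃ p, (fun x => (x, p)) '' ((T ∩ {x | K n < k n x}) ∪ (T ∩ {x | ¬ Dist n x (e n p)})) := by
    rintro ⟨x, p⟩ ⟨hx, hb⟩
    refine Set.mem_iUnion.mpr ⟨p, x, ?_, rfl⟩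
    by_cases hk : k n x ≤ K n
    · exact Or.inr ⟨hx, fun hd => hb ⟨hk, hd⟩⟩
    · exact Or.inl ⟨hx, not_le.mp hk⟩
  have hle := (Set.ncard_le_ncard hsub (Set.toFinite _)).trans (Set.ncard_iUnion_le_of_fintype _)
  have hle2 : {q : (Fin n → 𝓧) × (Fin (K n) → Bool) | q.1 ∈ T ∧
        ¬ (k n q.1 ≤ K n ∧ Dist n q.1 (e n q.2))}.ncard ≤
      ∑ p : Fin (K n) → Bool, ((T ∩ {x | K n < k n x}).ncard + (T ∩ {x | ¬ Dist n x (e n p)}).ncard) :=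
    hle.trans (Finset.sum_le_sum fun p _ =>
      (Set.ncard_image_le (Set.toFinite _)).trans (Set.ncard_union_le _ _))
  rw [Finset.sum_add_distrib] at hle2
  simp only [Finset.sum_const, Finset.card_univ, Fintype.card_pi, Fintype.card_bool, Finset.prod_const,
    Fintype.card_fin, smul_eq_mul] at hle2
  have hle3 : (({q : (Fin n → 𝓧) × (Fin (K n) → Bool) | q.1 ∈ T ∧
        ¬ (k n q.1 ≤ K n ∧ Dist n q.1 (e n q.2))}.ncard : ℕ) : ℝ) ≤
      2 ^ K n * ((T ∩ {x | K n < k n x}).ncard : ℝ) + ∑ p : Fin (K n) → Bool, ((T ∩ {x | ¬ Dist n x (e n p)}).ncard : ℝ) := by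
    exact_mod_cast hle2
  have h4 : (2:ℝ) ^ K n * ((T ∩ {x | K n < k n x}).ncard : ℝ) ≤ 2 ^ K n * (1 / 8 * T.ncard) := by
    gcongr
  have h5 : (4:ℝ) * ({q : (Fin n → 𝓧) × (Fin (K n) → Bool) | q.1 ∈ T ∧
        ¬ (k n q.1 ≤ K n ∧ Dist n q.1 (e n q.2))}.ncard : ℕ) ≤ T.ncard * 2 ^ K n := by
    linarith
  exact_mod_cast h5

lemma final_code {𝓧 𝓦 𝓩 Y : Type*} [Fintype 𝓧] [DecidableEq 𝓧] [Fintype 𝓩] [Nonempty 𝓩]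
    [Nonempty 𝓦] [Fintype Y] (P : 𝓧 → ℝ)
    (dL : 𝓧 → 𝓦 → ℝ) (dE : 𝓧 → 𝓩 → ℝ) (hzeroL : ∀ x, ∃ w, dL x w = 0)
    (Dc : ℝ) (hDc : 0 ≤ Dc) (Q : 𝓧 → ℝ) (n : ℕ)
    (k : (Fin n → 𝓧) → ℕ) (f : (Fin n → 𝓧) → (ℕ → Bool) → Y)
    (φ : Y → (ℕ → Bool) → (Fin n → 𝓦))
    (hfdep : ∀ (x : Fin n → 𝓧) (u u' : ℕ → Bool), (∀ i < k x, u i = u' i) → f x u = f x u')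
    (K : ℕ) (e : (Fin K → Bool) → (ℕ → Bool)) (he : ∀ p, prefixKey K (e p) = p)
    (N M : ℕ) (hN : (Fintype.card 𝓧) ^ n * 2 ^ K < 2 ^ N) (hM : 4 * (Fintype.card 𝓧) ^ n ≤ M)
    (k' : (Fin n → 𝓧) → ℕ) (hk' : ∀ x ∈ typeClass 𝓧 n Q, k' x = K) (B : ℝ) :
    ∃ (f' : (Fin n → 𝓧) → (ℕ → Bool) → Fin (N * M + (Fintype.card 𝓧) ^ n))
      (φ' : Fin (N * M + (Fintype.card 𝓧) ^ n) → (ℕ → Bool) → (Fin n → 𝓦)),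
      (∀ (x : Fin n → 𝓧) (u u' : ℕ → Bool), (∀ i < k' x, u i = u' i) → f' x u = f' x u') ∧
      (∀ (u : ℕ → Bool), ∀ x ∈ typeClass 𝓧 n Q, seqDist dL x (φ' (f' x u) u) ≤ Dc) ∧
      (0 < Dc → (∃ (x : Fin n → 𝓧) (w : Fin n → 𝓦), x ∉ typeClass 𝓧 n Q ∧ Dc ≤ seqDist dL x w ∧
          ∏ i, P (x i) ≤ B) →
        ∃ x1 : Fin n → 𝓧, ∏ i, P (x1 i) ≤ B ∧
          ∀ (u : ℕ → Bool) (x : Fin n → 𝓧), Dc ≤ seqDist dL x (φ' (f' x u) u) ↔ x = x1) ∧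
      (0 < n → (typeClass 𝓧 n Q).Nonempty →
        4 * {q : (Fin n → 𝓧) × (Fin K → Bool) | q.1 ∈ typeClass 𝓧 n Q ∧
          ¬ (k q.1 ≤ K ∧ seqDist dL q.1 (φ (f q.1 (e q.2)) (e q.2)) < Dc)}.ncard
            ≤ (typeClass 𝓧 n Q).ncard * 2 ^ K →
        ∀ D, condExigProb dE D Q k' f' ≤ N * condExigProb dE D Q k f) := by
  classical
  choose wz hwz using hzeroL
  have hz : ∀ x : Fin n → 𝓧, seqDist dL x (fun i => wz (x i)) = 0 := by
    intro x; simp [seqDist, hwz]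
  obtain ⟨g, hg1, hg2⟩ : ∃ g : (Fin n → 𝓧) → (Fin n → 𝓦),
      (∀ x ∈ typeClass 𝓧 n Q, seqDist dL x (g x) = 0) ∧
      (0 < Dc → (∃ (x : Fin n → 𝓧) (w : Fin n → 𝓦), x ∉ typeClass 𝓧 n Q ∧ Dc ≤ seqDist dL x w ∧
          ∏ i, P (x i) ≤ B) →
        ∃ x1 : Fin n → 𝓧, x1 ∉ typeClass 𝓧 n Q ∧ ∏ i, P (x1 i) ≤ B ∧
          ∀ (x : Fin n → 𝓧), Dc ≤ seqDist dL x (g x) ↔ x = x1) := by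
    by_cases hex : ∃ (x : Fin n → 𝓧) (w : Fin n → 𝓦), x ∉ typeClass 𝓧 n Q ∧ Dc ≤ seqDist dL x w ∧
          ∏ i, P (x i) ≤ B
    · obtain ⟨x1, w1, h1, h2, h3⟩ := hex
      refine ⟨fun x => if x = x1 then w1 else fun i => wz (x i), ?_, ?_⟩
      · intro x hx
        have : x ≠ x1 := fun h => h1 (h ▸ hx)
        simp only [if_neg this, hz]
      · intro hD _
        refine ⟨x1, h1, h3, fun x => ?_⟩
        by_cases hx : x = x1
        · subst hx; simpa using h2
        · beta_reduce
          rw [if_neg hx, hz]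
          exact ⟨fun h => absurd h (not_le.mpr hD), fun h => absurd h hx⟩
    · exact ⟨fun x i => wz (x i), fun x _ => hz x, fun _ h => absurd h hex⟩
  have hcard : Fintype.card ((Fin N × Fin M) ⊕ (Fin n → 𝓧)) = N * M + (Fintype.card 𝓧) ^ n := by
    simp
  let ε := Fintype.equivFinOfCardEq hcard
  by_cases hblk : 0 < n ∧ (typeClass 𝓧 n Q).Nonempty ∧ 
        4 * {q : (Fin n → 𝓧) × (Fin K → Bool) | q.1 ∈ typeClass 𝓧 n Q ∧
          ¬ (k q.1 ≤ K ∧ seqDist dL q.1 (φ (f q.1 (e q.2)) (e q.2)) < Dc)}.ncard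
            ≤ (typeClass 𝓧 n Q).ncard * 2 ^ K
  · obtain ⟨hn, hT, hbad⟩ := hblk
    obtain ⟨fs, φs, hs1, hs2⟩ := block_code dL dE Dc Q hn k f φ hfdep K e he hT hbad N M hN hM
    let f' : (Fin n → 𝓧) → (ℕ → Bool) → Fin (N * M + (Fintype.card 𝓧) ^ n) := fun x u =>
      ε (if x ∈ typeClass 𝓧 n Q then Sum.inl (fs x (prefixKey K u)) else Sum.inr x)
    let φ' : Fin (N * M + (Fintype.card 𝓧) ^ n) → (ℕ → Bool) → (Fin n → 𝓦) := fun y u =>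
      Sum.elim (fun c => φs c (prefixKey K u)) g (ε.symm y)
    have hin : ∀ u, ∀ x ∈ typeClass 𝓧 n Q, seqDist dL x (φ' (f' x u) u) < Dc := by
      intro u x hx
      have : φ' (f' x u) u = φs (fs x (prefixKey K u)) (prefixKey K u) := by
        simp only [φ', f', if_pos hx, Equiv.symm_apply_apply, Sum.elim_inl]
      rw [this]; exact hs1 x hx _
    have hout : ∀ u, ∀ x ∉ typeClass 𝓧 n Q, φ' (f' x u) u = g x := by
      intro u x hx
      simp only [φ', f', if_neg hx, Equiv.symm_apply_apply, Sum.elim_inr]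
    have hdep : ∀ (x : Fin n → 𝓧) (u u' : ℕ → Bool), (∀ i < k' x, u i = u' i) → f' x u = f' x u' := by
      intro x u u' huu
      by_cases hx : x ∈ typeClass 𝓧 n Q
      · have : prefixKey K u = prefixKey K u' := by
          funext i; exact huu i (by rw [hk' x hx]; exact i.2)
        simp only [f', this]
      · simp only [f', if_neg hx]
    refine ⟨f', φ', hdep, fun u x hx => (hin u x hx).le, ?_, ?_⟩
    · intro hD hex
      obtain ⟨x1, h1, h2, h3⟩ := hg2 hD hex
      refine ⟨x1, h2, fun u x => ?_⟩
      by_cases hx : x ∈ typeClass 𝓧 n Q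
      · have h4 := hin u x hx
        constructor
        · intro h; linarith
        · rintro rfl; exact absurd hx h1
      · rw [hout u x hx]; exact h3 x
    · intro _ _ _ D
      refine condExig_le dE D Q k' f' hdep K hk' hT _ fun σ => ?_
      have := hs2 D (fun c => σ (ε (Sum.inl c)))
      have heq : ∀ (x : Fin n → 𝓧) (p : Fin K → Bool),
          ind (x ∈ typeClass 𝓧 n Q ∧ seqDist dE x (σ (f' x (extKey p))) ≤ D) ≤
          ind (x ∈ typeClass 𝓧 n Q ∧ seqDist dE x (σ (ε (Sum.inl (fs x p)))) ≤ D) := by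
        intro x p
        refine ind_mono fun ⟨hx, h⟩ => ⟨hx, ?_⟩
        have hpre : prefixKey K (extKey p) = p := by
          funext i; simp [prefixKey, extKey]
        simpa only [f', if_pos hx, hpre] using h
      refine (Finset.sum_le_sum fun x _ => Finset.sum_le_sum fun p _ => heq x p).trans (this.trans (le_of_eq ?_))
      ring
  · let f' : (Fin n → 𝓧) → (ℕ → Bool) → Fin (N * M + (Fintype.card 𝓧) ^ n) := fun x u =>
      ε (Sum.inr x)
    let φ' : Fin (N * M + (Fintype.card 𝓧) ^ n) → (ℕ → Bool) → (Fin n → 𝓦) := fun y u =>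
      Sum.elim (fun c i => Classical.arbitrary 𝓦) g (ε.symm y)
    have hout : ∀ u, ∀ x, φ' (f' x u) u = g x := by
      intro u x
      simp only [φ', f', Equiv.symm_apply_apply, Sum.elim_inr]
    refine ⟨f', φ', fun _ _ _ _ => rfl, ?_, ?_, ?_⟩
    · intro u x hx
      rw [hout u, hg1 x hx]; exact hDc
    · intro hD hex
      obtain ⟨x1, h1, h2, h3⟩ := hg2 hD hex
      exact ⟨x1, h2, fun u x => by rw [hout u]; exact h3 x⟩
    · intro h1 h2 h3
      exact absurd ⟨h1, h2, h3⟩ hblk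

/-- **Reduction to fixed key rate and zero excess-distortion on a type class.** Given a
sequence of variable key rate secure rate-distortion codes satisfying the compression
constraint `(Rc,Dc,Ec)`, and a full-support type `Q` with `D(Q‖P) < Ec`, there is a new
sequence of codes which on `T_n(Q)` has a fixed key rate `R* ≤ R̄(Q) + δ` and zero conditional
excess-distortion probability, satisfies the compression constraint `(log₂|𝒳|, Dc, Ec)`, and
whose conditional limsup exiguous-distortion exponent is smaller by at most `δ`. -/
theorem reduction_fixed_key_rate
    {𝓧 𝓦 𝓩 : Type*} [Fintype 𝓧] [DecidableEq 𝓧] [Fintype 𝓦] [Fintype 𝓩]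
    [Nonempty 𝓧] [Nonempty 𝓦] [Nonempty 𝓩]
    (P : 𝓧 → ℝ) (hP : IsDist P) (hPfull : ∀ x, 0 < P x)
    (dL : 𝓧 → 𝓦 → ℝ) (dE : 𝓧 → 𝓩 → ℝ)
    (hdL0 : ∀ x w, 0 ≤ dL x w) (hdE0 : ∀ x z, 0 ≤ dE x z)
    (hzeroL : ∀ x, ∃ w, dL x w = 0) (hzeroE : ∀ x, ∃ z, dE x z = 0)
    (hlenient : ∀ (n : ℕ) (w : Fin n → 𝓦), ∃ z : Fin n → 𝓩, ∀ x : Fin n → 𝓧,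
      seqDist dE x z ≤ seqDist dL x w)
    (Dc Rc : ℝ) (hDc : 0 ≤ Dc) (Ec : ℝ) (hEc : 0 < Ec)
    -- the original code sequence S
    (m : ℕ → ℕ) (hm : ∀ n, 0 < m n)
    (k : ∀ n : ℕ, (Fin n → 𝓧) → ℕ)
    (f : ∀ n : ℕ, (Fin n → 𝓧) → (ℕ → Bool) → Fin (m n))
    (φ : ∀ n : ℕ, Fin (m n) → (ℕ → Bool) → (Fin n → 𝓦))
    (hfdep : ∀ (n : ℕ) (x : Fin n → 𝓧) (u u' : ℕ → Bool),
      (∀ i < k n x, u i = u' i) → f n x u = f n x u')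
    (hkbd : ∀ (n : ℕ) (x : Fin n → 𝓧), (k n x : ℝ) ≤ n * Real.logb 2 (Fintype.card 𝓧))
    (Rbar : (𝓧 → ℝ) → ℝ)
    (hconv : ∀ δ > (0 : ℝ), ∀ ε > (0 : ℝ), ∃ N : ℕ, ∀ n ≥ N, ∀ Q' : 𝓧 → ℝ,
      (∃ x : Fin n → 𝓧, empDist x = Q') →
      ((typeClass 𝓧 n Q' ∩ {x | δ < |(k n x : ℝ) / n - Rbar Q'|}).ncard : ℝ)
          / ((typeClass 𝓧 n Q').ncard : ℝ) ≤ ε)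
    (hadm : ∀ (n : ℕ) (x : Fin n → 𝓧) (u u' : ℕ → Bool),
      f n x u = f n x u' → ∀ i < k n x, u i = u' i)
    (hrate : Filter.limsup (fun n : ℕ => (n : ℝ)⁻¹ * Real.logb 2 (m n)) Filter.atTop ≤ Rc)
    (hexcess : ∀ u : ℕ → Bool,
      Ec ≤ Filter.liminf (fun n : ℕ =>
        -(n : ℝ)⁻¹ * Real.logb 2
          (∑ x : Fin n → 𝓧, (∏ i, P (x i)) *
            ind (Dc ≤ seqDist dL x (φ n (f n x u) u)))) Filter.atTop)
    -- the type Q : full support, D(Q‖P) < Ec, with its subsequence of blocklengths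
    (Q : 𝓧 → ℝ) (hQfull : ∀ a, 0 < Q a)
    (hQ : ∃ (n : ℕ) (x : Fin n → 𝓧), 0 < n ∧ empDist x = Q)
    (hQEc : KL Q P < Ec)
    (nl : ℕ → ℕ) (hnl : StrictMono nl)
    (hnlne : ∀ l, (typeClass 𝓧 (nl l) Q).Nonempty)
    (hnlall : ∀ n, 0 < n → (typeClass 𝓧 n Q).Nonempty → ∃ l, nl l = n)
    (δ : ℝ) (hδ : 0 < δ) :
    ∃ (m' : ℕ → ℕ) (k' : ∀ n : ℕ, (Fin n → 𝓧) → ℕ)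
      (f' : ∀ n : ℕ, (Fin n → 𝓧) → (ℕ → Bool) → Fin (m' n))
      (φ' : ∀ n : ℕ, Fin (m' n) → (ℕ → Bool) → (Fin n → 𝓦)) (Rstar : ℝ),
      -- well-formedness: the new encoder uses only the first `k' n x` key bits
      (∀ (n : ℕ) (x : Fin n → 𝓧) (u u' : ℕ → Bool),
        (∀ i < k' n x, u i = u' i) → f' n x u = f' n x u') ∧
      -- (1) fixed key rate `R* ≤ R̄(Q) + δ` on the type class of Q
      Rstar ≤ Rbar Q + δ ∧
      (∀ (n : ℕ) (x : Fin n → 𝓧), x ∈ typeClass 𝓧 n Q → k' n x = ⌈(n : ℝ) * Rstar⌉₊) ∧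
      -- (2) zero conditional excess-distortion probability on T_n(Q) ...
      (∀ (n : ℕ) (u : ℕ → Bool) (x : Fin n → 𝓧), x ∈ typeClass 𝓧 n Q →
        seqDist dL x (φ' n (f' n x u) u) ≤ Dc) ∧
      -- ... and the compression constraint (log₂|𝒳|, Dc, Ec)
      Filter.limsup (fun n : ℕ => (n : ℝ)⁻¹ * Real.logb 2 (m' n)) Filter.atTop
          ≤ Real.logb 2 (Fintype.card 𝓧) ∧
      (∀ u : ℕ → Bool,
        Ec ≤ Filter.liminf (fun n : ℕ =>
          -(n : ℝ)⁻¹ * Real.logb 2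
            (∑ x : Fin n → 𝓧, (∏ i, P (x i)) *
              ind (Dc ≤ seqDist dL x (φ' n (f' n x u) u)))) Filter.atTop) ∧
      -- (3) the conditional limsup exiguous-distortion exponent decreases by at most δ
      (∀ D : ℝ, Dc ≤ D →
        Filter.limsup (fun l : ℕ =>
            -(nl l : ℝ)⁻¹ * Real.logb 2 (condExigProb dE D Q (k (nl l)) (f (nl l))))
          Filter.atTop
        ≤ Filter.limsup (fun l : ℕ =>
            -(nl l : ℝ)⁻¹ * Real.logb 2 (condExigProb dE D Q (k' (nl l)) (f' (nl l))))
          Filter.atTop + δ) := by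
  classical
  -- basic consequences of the excess-distortion hypothesis
  set q := Fintype.card 𝓧 with hq
  have hqpos : 0 < q := Fintype.card_pos
  have hev0 := excess_pos_lt P hP (fun n x => Dc ≤ seqDist dL x (φ n (f n x fun _ => false) fun _ => false))
    Ec hEc (hexcess fun _ => false)
  obtain ⟨n0, hn01, hn02⟩ := hev0.exists
  have hDcpos : 0 < Dc := by
    by_contra hneg
    have h0 : Dc ≤ 0 := not_lt.mp hneg
    have hone : ∑ x : Fin n0 → 𝓧, (∏ i, P (x i)) *
        ind (Dc ≤ seqDist dL x (φ n0 (f n0 x fun _ => false) fun _ => false)) = 1 := by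
      rw [← prod_P_le_one (n := n0) P hP]
      refine Finset.sum_congr rfl fun x _ => ?_
      rw [ind_pos', mul_one]
      refine h0.trans ?_
      unfold seqDist
      exact mul_nonneg (by positivity) (Finset.sum_nonneg fun i _ => hdL0 _ _)
    linarith
  have hnt : Nontrivial 𝓧 := by
    rw [← not_subsingleton_iff_nontrivial]
    intro hss
    obtain ⟨x, _, hx⟩ := exists_of_excess_pos P hP _ hn01
    have h1 : ∀ a, P a = 1 := by
      intro a
      rw [← hP.2]
      symm
      exact Fintype.sum_eq_single a fun b hb => absurd (Subsingleton.elim b a) hb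
    simp only [h1, Finset.prod_const_one] at hx hn02
    linarith
  obtain ⟨am, ham⟩ := Finite.exists_min P
  set Pm := P am with hPm
  have hPmpos : 0 < Pm := hPfull am
  -- parameters
  set R := Rbar Q + δ with hR
  let K : ℕ → ℕ := fun n => ⌈(n : ℝ) * R⌉₊
  let N : ℕ → ℕ := fun n => n * q + K n + 1
  let M : ℕ → ℕ := fun n => 4 * q ^ n
  have hN : ∀ n, q ^ n * 2 ^ K n < 2 ^ N n := by
    intro n
    have h1 : q ^ n ≤ 2 ^ (n * q) := by
      rw [mul_comm, pow_mul]
      exact Nat.pow_le_pow_left Nat.lt_two_pow_self.le n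
    calc q ^ n * 2 ^ K n ≤ 2 ^ (n * q) * 2 ^ K n := Nat.mul_le_mul_right _ h1
      _ = 2 ^ (n * q + K n) := by rw [pow_add]
      _ < 2 ^ N n := Nat.pow_lt_pow_right (by norm_num) (by simp [N])
  set C : ℝ := q + |R| + 2 with hC
  have hCpos : 0 < C := by positivity
  have hNle : ∀ n, 0 < n → (N n : ℝ) ≤ C * n := by
    intro n hn
    have hn1 : (1:ℝ) ≤ n := by exact_mod_cast hn
    have hK : (K n : ℝ) ≤ n * |R| + 1 := by
      have h1 : (K n : ℝ) ≤ (⌈(n:ℝ) * |R|⌉₊ : ℝ) := by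
        have : K n ≤ ⌈(n:ℝ) * |R|⌉₊ := Nat.ceil_mono (by gcongr; exact le_abs_self R)
        exact_mod_cast this
      exact h1.trans (Nat.ceil_lt_add_one (by positivity)).le
    simp only [N]
    push_cast
    rw [hC]
    nlinarith
  -- key extension
  obtain ⟨e, he1, he2⟩ := key_extension K
    (fun n u => ((typeClass 𝓧 n Q ∩ {x | Dc ≤ seqDist dL x (φ n (f n x u) u)}).ncard : ℝ) /
      ((typeClass 𝓧 n Q).ncard : ℝ))
    (fun n u => by positivity)
    (fun n u => by
      refine div_le_one_of_le₀ ?_ (by positivity)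
      exact_mod_cast Set.ncard_le_ncard Set.inter_subset_left (Set.toFinite _))
    (fun u => excess_fraction P hP hPfull Q hQfull
      (fun n x => Dc ≤ seqDist dL x (φ n (f n x u) u)) Ec hQEc (hexcess u))
  have hbad := bad_eventually Q k (fun n x u => seqDist dL x (φ n (f n x u) u) < Dc) K e (by
      obtain ⟨N0, hN0⟩ := hconv δ hδ (1/8) (by norm_num)
      filter_upwards [Filter.eventually_ge_atTop N0, Filter.eventually_gt_atTop 0] with n hn hnpos hT
      refine le_trans ?_ (hN0 n hn Q hT)
      refine div_le_div_of_nonneg_right ?_ (by positivity)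
      refine Nat.cast_le.mpr (Set.ncard_le_ncard ?_ (Set.toFinite _))
      · rintro x ⟨hxT, hlt⟩
        have hlt : K n < k n x := hlt
        refine ⟨hxT, ?_⟩
        show δ < |(k n x : ℝ) / n - Rbar Q|
        by_contra hle
        have hle := (abs_le.mp (not_lt.mp hle)).2
        have hn' : (0:ℝ) < n := by exact_mod_cast hnpos
        have h1 : (k n x : ℝ) ≤ n * R := by
          rw [sub_le_iff_le_add, div_le_iff₀ hn'] at hle
          rw [hR]; linarith
        have h2 : k n x ≤ K n := by
          exact_mod_cast h1.trans (Nat.le_ceil _)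
        exact absurd hlt (not_lt.mpr h2)) (by
      simpa only [not_lt] using he2)
  -- the code
  let k' : ∀ n : ℕ, (Fin n → 𝓧) → ℕ := fun n x => if x ∈ typeClass 𝓧 n Q then K n else 0
  have hk' : ∀ n, ∀ x ∈ typeClass 𝓧 n Q, k' n x = K n := fun n x hx => if_pos hx
  let B : ℕ → ℝ := fun n => (∑ x : Fin n → 𝓧, (∏ i, P (x i)) *
    ind (Dc ≤ seqDist dL x (φ n (f n x fun _ => false) fun _ => false))) / Pm
  choose f' φ' hdep hin hone hexig using fun n => final_code P dL dE hzeroL Dc hDc Q n (k n) (f n) (φ n)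
    (hfdep n) (K n) (e n) (he1 n) (N n) (M n) (hN n) le_rfl (k' n) (hk' n) (B n)
  refine ⟨fun n => N n * M n + q ^ n, k', f', φ', R, hdep, le_rfl, hk', hin, ?_, ?_, ?_⟩
  · -- rate
    have hup : ∀ᶠ n : ℕ in Filter.atTop, (n:ℝ)⁻¹ * Real.logb 2 ((N n * M n + q ^ n : ℕ) : ℝ) ≤
        Real.logb 2 q + (n:ℝ)⁻¹ * Real.logb 2 ((4 * C + 1) * n) := by
      filter_upwards [Filter.eventually_gt_atTop 0] with n hn
      have hn' : (0:ℝ) < n := by exact_mod_cast hn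
      have hn1 : (1:ℝ) ≤ n := by exact_mod_cast hn
      have hq' : (0:ℝ) < q := by exact_mod_cast hqpos
      have h1 : ((N n * M n + q ^ n : ℕ) : ℝ) ≤ (q:ℝ) ^ n * ((4 * C + 1) * n) := by
        have h2 := hNle n hn
        simp only [M]
        push_cast
        have h3 : (0:ℝ) < (q:ℝ) ^ n := by positivity
        have h4 : (N n : ℝ) * (4 * (q:ℝ) ^ n) ≤ (C * n) * (4 * (q:ℝ) ^ n) := by gcongr
        nlinarith
      have h5 : (0:ℝ) < ((N n * M n + q ^ n : ℕ) : ℝ) := by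
        have : 0 < N n * M n + q ^ n := by positivity
        exact_mod_cast this
      have h6 : Real.logb 2 ((N n * M n + q ^ n : ℕ) : ℝ) ≤
          n * Real.logb 2 q + Real.logb 2 ((4 * C + 1) * n) := by
        rw [← Real.logb_pow, ← Real.logb_mul (by positivity) (by positivity)]
        exact Real.logb_le_logb_of_le (by norm_num) h5 h1
      calc (n:ℝ)⁻¹ * Real.logb 2 ((N n * M n + q ^ n : ℕ) : ℝ) ≤
          (n:ℝ)⁻¹ * (n * Real.logb 2 q + Real.logb 2 ((4 * C + 1) * n)) := by gcongr
        _ = _ := by field_simp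
    have hlim : Filter.Tendsto (fun n : ℕ => Real.logb 2 q + (n:ℝ)⁻¹ * Real.logb 2 ((4 * C + 1) * n))
        Filter.atTop (nhds (Real.logb 2 q)) := by
      simpa using (tendsto_log_lin (4 * C + 1) (by positivity)).const_add (Real.logb 2 q)
    rw [← hlim.limsup_eq]
    refine Filter.limsup_le_limsup hup ?_ hlim.isBoundedUnder_le
    refine Filter.IsBoundedUnder.isCoboundedUnder_le ?_
    refine Filter.isBoundedUnder_of ⟨0, fun n => ?_⟩
    have h1 : (1:ℝ) ≤ ((N n * M n + q ^ n : ℕ) : ℝ) := by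
      have : 1 ≤ N n * M n + q ^ n := by
        have : 0 < q ^ n := by positivity
        omega
      exact_mod_cast this
    exact mul_nonneg (by positivity) (Real.logb_nonneg (by norm_num) h1)
  · -- excess distortion
    intro u
    have hkey : ∀ᶠ n : ℕ in Filter.atTop, 0 < n ∧ ∃ x1 : Fin n → 𝓧, ∏ i, P (x1 i) ≤ B n ∧
        ∑ x : Fin n → 𝓧, (∏ i, P (x i)) * ind (Dc ≤ seqDist dL x (φ' n (f' n x u) u)) =
          ∏ i, P (x1 i) := by
      filter_upwards [hev0, Filter.eventually_gt_atTop 0] with n hn hnpos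
      refine ⟨hnpos, ?_⟩
      obtain ⟨x0, hx0, hx0'⟩ := exists_of_excess_pos P hP _ hn.1
      obtain ⟨x, w, h1, h2, h3⟩ := xdag_exists P hP hPfull dL Q hQfull Dc Pm hPmpos ham hnpos x0 _ hx0
      obtain ⟨x1, h4, h5⟩ := hone n hDcpos ⟨x, w, h1, h2, h3.trans (by
        simp only [B]; gcongr)⟩
      refine ⟨x1, h4, ?_⟩
      rw [Fintype.sum_eq_single x1]
      · rw [ind_pos' ((h5 u x1).mpr rfl), mul_one]
      · intro y hy
        rw [ind_neg' (fun h => hy ((h5 u y).mp h)), mul_zero]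
    refine le_liminf_aux _ Ec (-Real.logb 2 Pm) ?_ ?_
    · intro E1 hE1
      have hlim : Filter.Tendsto (fun n : ℕ => (n:ℝ)⁻¹ * Real.logb 2 Pm) Filter.atTop (nhds 0) := by
        simpa using (tendsto_inv_atTop_nhds_zero_nat (𝕜 := ℝ)).mul_const (Real.logb 2 Pm)
      have hlim' := hlim.eventually_const_lt (show -((Ec - E1) / 2) < 0 by linarith)
      have hr := excess_eventually P hP
        (fun n x => Dc ≤ seqDist dL x (φ n (f n x fun _ => false) fun _ => false))
        Ec ((Ec + E1) / 2) (by linarith) (hexcess fun _ => false)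
      filter_upwards [hkey, hlim', hr, hev0] with n hk1 hk2 hk3 hk4
      obtain ⟨hnpos, x1, h1, h2⟩ := hk1
      rw [h2]
      have hp : 0 < ∏ i, P (x1 i) := Finset.prod_pos fun i _ => hPfull _
      have h3 : Real.logb 2 (∏ i, P (x1 i)) ≤ Real.logb 2 (B n) :=
        Real.logb_le_logb_of_le (by norm_num) hp h1
      simp only [B] at h3
      rw [Real.logb_div hk4.1.ne' hPmpos.ne'] at h3
      have h4 : (n:ℝ)⁻¹ * Real.logb 2 (∏ i, P (x1 i)) ≤ (n:ℝ)⁻¹ * (_ - _) :=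
        mul_le_mul_of_nonneg_left h3 (by positivity)
      rw [mul_sub] at h4
      linarith
    · filter_upwards [hkey] with n hk1
      obtain ⟨hnpos, x1, h1, h2⟩ := hk1
      rw [h2]
      have h3 : Pm ^ n ≤ ∏ i, P (x1 i) := by
        calc Pm ^ n = ∏ i : Fin n, Pm := by simp
          _ ≤ _ := Finset.prod_le_prod (fun _ _ => hPmpos.le) fun i _ => ham _
      have h4 : Real.logb 2 (Pm ^ n) ≤ Real.logb 2 (∏ i, P (x1 i)) :=
        Real.logb_le_logb_of_le (by norm_num) (by positivity) h3
      rw [Real.logb_pow] at h4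
      have hn' : (0:ℝ) < n := by exact_mod_cast hnpos
      have h5 : (n:ℝ)⁻¹ * (n * Real.logb 2 Pm) ≤ (n:ℝ)⁻¹ * Real.logb 2 (∏ i, P (x1 i)) := by gcongr
      rw [inv_mul_cancel_left₀ hn'.ne'] at h5
      linarith
  · -- exiguous distortion exponent
    intro D hD
    have hD0 : 0 ≤ D := hDc.trans hD
    have hnlpos : ∀ l, 0 < nl l := by
      intro l
      rcases Nat.eq_zero_or_pos (nl l) with h0 | h0
      · exfalso
        obtain ⟨x, hx⟩ := hnlne l
        have hx' : empDist x = Q := hx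
        have := congrFun hx' am
        have h2 := hQfull am
        rw [← this] at h2
        simp [empDist, h0] at h2
      · exact h0
    have hcpos : ∀ l, (((q:ℝ)) ^ nl l)⁻¹ ≤ condExigProb dE D Q (k (nl l)) (f (nl l)) := fun l =>
      condExig_lower dE hzeroE D hD0 Q _ _ (hfdep _) (hnlne l)
    have hcpos' : ∀ l, (((q:ℝ)) ^ nl l)⁻¹ ≤ condExigProb dE D Q (k' (nl l)) (f' (nl l)) := fun l =>
      condExig_lower dE hzeroE D hD0 Q _ _ (hdep _) (hnlne l)
    have hq' : (0:ℝ) < q := by exact_mod_cast hqpos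
    have hbdup : ∀ l (p : ℝ), ((q:ℝ) ^ nl l)⁻¹ ≤ p → -(nl l : ℝ)⁻¹ * Real.logb 2 p ≤ Real.logb 2 q := by
      intro l p hp
      have h1 : Real.logb 2 (((q:ℝ) ^ nl l)⁻¹) ≤ Real.logb 2 p :=
        Real.logb_le_logb_of_le (by norm_num) (by positivity) hp
      rw [Real.logb_inv, Real.logb_pow] at h1
      have hn' : (0:ℝ) < nl l := by exact_mod_cast hnlpos l
      have h2 : (nl l:ℝ)⁻¹ * (-(nl l * Real.logb 2 q)) ≤ (nl l:ℝ)⁻¹ * Real.logb 2 p := by gcongr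
      rw [mul_neg, inv_mul_cancel_left₀ hn'.ne'] at h2
      linarith
    have hqn : ∀ l, (0:ℝ) < ((q:ℝ) ^ nl l)⁻¹ := fun l => by positivity
    have hev : ∀ᶠ l in Filter.atTop,
        -(nl l : ℝ)⁻¹ * Real.logb 2 (condExigProb dE D Q (k (nl l)) (f (nl l))) ≤
        -(nl l : ℝ)⁻¹ * Real.logb 2 (condExigProb dE D Q (k' (nl l)) (f' (nl l))) + δ := by
      have hnlt := hnl.tendsto_atTop
      filter_upwards [hnlt.eventually hbad,
        hnlt.eventually ((tendsto_log_lin C hCpos).eventually_lt_const hδ)] with l h1 h2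
      have h3 := hexig (nl l) (hnlpos l) (hnlne l) (h1 (hnlne l)) D
      have hc := (hqn l).trans_le (hcpos l)
      have hc' := (hqn l).trans_le (hcpos' l)
      have hn' : (0:ℝ) < nl l := by exact_mod_cast hnlpos l
      have hNpos : (0:ℝ) < N (nl l) := by
        have : 0 < N (nl l) := by simp only [N]; omega
        exact_mod_cast this
      have h4 : Real.logb 2 (condExigProb dE D Q (k' (nl l)) (f' (nl l))) ≤
          Real.logb 2 (C * nl l) + Real.logb 2 (condExigProb dE D Q (k (nl l)) (f (nl l))) := by
        rw [← Real.logb_mul (by positivity) hc.ne']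
        refine Real.logb_le_logb_of_le (by norm_num) hc' (h3.trans ?_)
        exact mul_le_mul_of_nonneg_right (hNle _ (hnlpos l)) hc.le
      have h5 := mul_le_mul_of_nonneg_left h4 (inv_nonneg.mpr hn'.le)
      rw [mul_add] at h5
      linarith
    have hbd : Filter.IsBoundedUnder (· ≤ ·) Filter.atTop (fun l : ℕ =>
        -(nl l : ℝ)⁻¹ * Real.logb 2 (condExigProb dE D Q (k' (nl l)) (f' (nl l)))) :=
      Filter.isBoundedUnder_of ⟨_, fun l => hbdup l _ (hcpos' l)⟩
    have hcb : Filter.IsCoboundedUnder (· ≤ ·) Filter.atTop (fun l : ℕ =>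
        -(nl l : ℝ)⁻¹ * Real.logb 2 (condExigProb dE D Q (k' (nl l)) (f' (nl l)))) :=
      Filter.IsBoundedUnder.isCoboundedUnder_le (Filter.isBoundedUnder_of ⟨0, fun l =>
        rate_nonneg ((hqn l).trans_le (hcpos' l)).le (condExig_le_one dE D Q _ _ (hnlne l))⟩)
    rw [← limsup_add_const _ _ _ hbd hcb]
    refine Filter.limsup_le_limsup hev ?_ ?_
    · exact Filter.IsBoundedUnder.isCoboundedUnder_le (Filter.isBoundedUnder_of ⟨0, fun l =>
        rate_nonneg ((hqn l).trans_le (hcpos l)).le (condExig_le_one dE D Q _ _ (hnlne l))⟩)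
    · exact Filter.isBoundedUnder_of ⟨Real.logb 2 q + δ, fun l => by
        have := hbdup l _ (hcpos' l)
        linarith⟩

end
end

section
/- Blind-estimation exiguous-distortion bound on a type class: Let 𝒳, 𝒵 be finite alphabets, d_E : 𝒳×𝒵 → [0,∞) a distortion measure, D ≥ 0, n ≥ 1, and Q ∈ 𝒫_n(𝒳) with T_n(Q) nonempty. Then for every z ∈ 𝒵^n, |{x ∈ T_n(Q) : d_E(x,z) ≤ D}| / |T_n(Q)| ≤ (n+1)^{|𝒳|(|𝒵|+1)} · 2^{−n R_{d_E}(Q,D)}. Equivalently, if X is uniformly distributed on T_n(Q), then P[ d_E(X,z) ≤ D ] ≤ (n+1)^{|𝒳|(|𝒵|+1)} · 2^{−n R_{d_E}(Q,D)} for every fixed z ∈ 𝒵^n. -/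
open scoped BigOperators

noncomputable section

/-- Mutual information (base 2) of a joint distribution on `A × B`. -/
def mutInfo {A B : Type*} [Fintype A] [Fintype B] (q : A × B → ℝ) : ℝ :=
  ∑ p : A × B, q p * Real.logb 2 (q p / ((∑ b, q (p.1, b)) * (∑ a, q (a, p.2))))

/-- Rate-distortion function of `Q` under distortion `d` at level `D`. -/
def rateDist {A B : Type*} [Fintype A] [Fintype B] (d : A → B → ℝ) (Q : A → ℝ) (D : ℝ) : ℝ :=
  sInf {r | ∃ q : A × B → ℝ, IsDist q ∧ (∀ a, ∑ b, q (a, b) = Q a) ∧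
    (∑ p : A × B, q p * d p.1 p.2) ≤ D ∧ r = mutInfo q}

/-- Number of occurrences of a letter. -/
def cnt {A : Type*} [DecidableEq A] {n : ℕ} (x : Fin n → A) (a : A) : ℕ :=
  (Finset.univ.filter fun i => x i = a).card

section helpers

variable {A B : Type*} [Fintype A] [DecidableEq A] [Fintype B] [DecidableEq B] {n : ℕ}

lemma cnt_le (x : Fin n → A) (a : A) : cnt x a ≤ n := by
  unfold cnt
  exact (Finset.card_le_univ _).trans (by simp)

lemma sum_cnt (x : Fin n → A) : ∑ a, cnt x a = n := by
  unfold cnt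
  have := Finset.card_eq_sum_card_fiberwise (s := (Finset.univ : Finset (Fin n)))
    (t := (Finset.univ : Finset A)) (f := x) (fun i _ => by simp)
  simpa using this.symm

lemma sum_cnt_mul (x : Fin n → A) (f : A → ℝ) : ∑ i, f (x i) = ∑ a, cnt x a * f a := by
  unfold cnt
  rw [← Finset.sum_fiberwise' _ x f]
  simp

lemma prod_cnt {M : Type*} [CommMonoid M] (x : Fin n → A) (f : A → M) :
    ∏ i, f (x i) = ∏ a, f a ^ cnt x a := by
  unfold cnt
  rw [← Finset.prod_fiberwise' _ x f]
  simp

lemma exists_perm (x y : Fin n → A) (h : cnt x = cnt y) :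
    ∃ σ : Equiv.Perm (Fin n), x ∘ σ = y := by
  have h1 : ∀ a, Nonempty ({i // y i = a} ≃ {i // x i = a}) := fun a => by
    refine ⟨Fintype.equivOfCardEq ?_⟩
    have := congrFun h a
    simp only [cnt] at this
    rw [Fintype.card_subtype, Fintype.card_subtype, this]
  let e := fun a => (h1 a).some
  refine ⟨(Equiv.sigmaFiberEquiv y).symm.trans
    ((Equiv.sigmaCongrRight e).trans (Equiv.sigmaFiberEquiv x)), ?_⟩
  funext i
  exact (e (y i) ⟨i, rfl⟩).2

lemma tcard (x0 : Fin n → A) :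
    (Finset.univ.filter fun x : Fin n → A => cnt x = cnt x0).card
      * ∏ a, (cnt x0 a).factorial = n.factorial := by
  have h1 := Finset.card_eq_sum_card_fiberwise
    (s := (Finset.univ : Finset (Equiv.Perm (Fin n))))
    (t := Finset.univ.filter fun x : Fin n → A => cnt x = cnt x0)
    (f := fun σ : Equiv.Perm (Fin n) => x0 ∘ ⇑σ) (fun σ _ => by
      simp only [Finset.coe_filter, Finset.mem_univ, true_and, Set.mem_ofPred_eq]
      funext a
      unfold cnt
      refine Finset.card_equiv σ ?_
      simp)
  rw [Finset.card_univ, Fintype.card_perm, Fintype.card_fin] at h1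
  rw [h1, ← smul_eq_mul, ← Finset.sum_const]
  refine Finset.sum_congr rfl fun x hx => ?_
  simp only [Finset.mem_filter, Finset.mem_univ, true_and] at hx
  obtain ⟨σ, hσ⟩ := exists_perm x0 x hx.symm
  have h2 := DomMulAct.stabilizer_card x
  have h3 : ∀ a, Fintype.card {i // x i = a} = cnt x0 a := fun a => by
    rw [← hx, Fintype.card_subtype]; rfl
  simp only [h3] at h2
  rw [← h2, Fintype.card_subtype]
  refine Finset.card_equiv (Equiv.mulLeft σ) fun g => ?_
  simp only [Finset.mem_filter, Finset.mem_univ, true_and, Equiv.coe_mulLeft,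
    Equiv.Perm.coe_mul, ← hσ]
  rfl

lemma pow_fact (k m : ℕ) : k ^ m * k.factorial ≤ k ^ k * m.factorial := by
  rcases le_total k m with h | h
  · have := Nat.factorial_mul_pow_sub_le_factorial h
    calc k ^ m * k.factorial = k ^ k * (k.factorial * k ^ (m - k)) := by
          rw [← Nat.add_sub_cancel' h, pow_add]; simp; ring
      _ ≤ _ := by gcongr
  · have h1 := Nat.factorial_mul_descFactorial (Nat.sub_le k m)
    have h2 := Nat.descFactorial_le_pow k (k - m)
    rw [Nat.sub_sub_self h] at h1
    calc k ^ m * k.factorial = k ^ m * m.factorial * k.descFactorial (k - m) := by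
          rw [← h1]; ring
      _ ≤ k ^ m * m.factorial * k ^ (k - m) := by gcongr
      _ = (k ^ m * k ^ (k - m)) * m.factorial := by ring
      _ = _ := by rw [← pow_add, Nat.add_sub_cancel' h]

lemma tclass_le (x0 y : Fin n → A) :
    (Finset.univ.filter fun x : Fin n → A => cnt x = cnt y).card * ∏ a, cnt x0 a ^ cnt y a
    ≤ (Finset.univ.filter fun x : Fin n → A => cnt x = cnt x0).card
      * ∏ a, cnt x0 a ^ cnt x0 a := by
  have h1 := tcard x0
  have h2 := tcard y
  have h3 : (∏ a, cnt x0 a ^ cnt y a) * ∏ a, (cnt x0 a).factorial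
      ≤ (∏ a, cnt x0 a ^ cnt x0 a) * ∏ a, (cnt y a).factorial := by
    rw [← Finset.prod_mul_distrib, ← Finset.prod_mul_distrib]
    exact Finset.prod_le_prod' fun a _ => pow_fact _ _
  have p1 : 0 < ∏ a, (cnt x0 a).factorial := Finset.prod_pos fun a _ => Nat.factorial_pos _
  have p2 : 0 < ∏ a, (cnt y a).factorial := Finset.prod_pos fun a _ => Nat.factorial_pos _
  set T0 := (Finset.univ.filter fun x : Fin n → A => cnt x = cnt x0).card
  set Ty := (Finset.univ.filter fun x : Fin n → A => cnt x = cnt y).card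
  refine Nat.le_of_mul_le_mul_right ?_ (Nat.mul_pos p1 p2)
  calc _ = (Ty * ∏ a, (cnt y a).factorial) *
        ((∏ a, cnt x0 a ^ cnt y a) * ∏ a, (cnt x0 a).factorial) := by ring
    _ ≤ (Ty * ∏ a, (cnt y a).factorial) *
        ((∏ a, cnt x0 a ^ cnt x0 a) * ∏ a, (cnt y a).factorial) := by gcongr
    _ = (T0 * ∏ a, (cnt x0 a).factorial) *
        ((∏ a, cnt x0 a ^ cnt x0 a) * ∏ a, (cnt y a).factorial) := by rw [h1, h2]
    _ = _ := by ring

lemma card_image_cnt (S : Finset (Fin n → A)) :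
    (S.image fun x => cnt x).card ≤ (n + 1) ^ Fintype.card A := by
  have : (S.image fun x => cnt x) ⊆ Fintype.piFinset fun _ : A => Finset.range (n + 1) := by
    intro f hf
    obtain ⟨x, _, rfl⟩ := Finset.mem_image.1 hf
    simp only [Fintype.mem_piFinset, Finset.mem_range]
    exact fun a => Nat.lt_succ_of_le (cnt_le x a)
  refine (Finset.card_le_card this).trans ?_
  simp

lemma tclass_lower (x0 : Fin n → A) :
    n ^ n ≤ (n + 1) ^ Fintype.card A *
      ((Finset.univ.filter fun x : Fin n → A => cnt x = cnt x0).card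
      * ∏ a, cnt x0 a ^ cnt x0 a) := by
  have h1 : n ^ n = ∑ x : Fin n → A, ∏ i, cnt x0 (x i) := by
    have := Finset.prod_univ_sum (fun _ : Fin n => (Finset.univ : Finset A))
      (fun _ a => cnt x0 a)
    simpa [sum_cnt] using this
  rw [h1, ← Finset.sum_fiberwise_of_maps_to (t := Finset.univ.image fun x : Fin n → A => cnt x)
    (g := fun x => cnt x) (fun x _ => Finset.mem_image_of_mem _ (Finset.mem_univ x))]
  refine (Finset.sum_le_card_nsmul _ _ _ ?_).trans
    (Nat.mul_le_mul_right _ (card_image_cnt _))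
  intro m hm
  obtain ⟨y, _, rfl⟩ := Finset.mem_image.1 hm
  refine le_trans (le_of_eq ?_) (tclass_le x0 y)
  rw [← smul_eq_mul, ← Finset.sum_const]
  refine Finset.sum_congr rfl fun x hx => ?_
  rw [prod_cnt x (cnt x0), (Finset.mem_filter.1 hx).2]

/-- Pair sequence. -/
def pr (x : Fin n → A) (z : Fin n → B) : Fin n → A × B := fun i => (x i, z i)

lemma marg_left (x : Fin n → A) (z : Fin n → B) (a : A) :
    ∑ b, cnt (pr x z) (a, b) = cnt x a := by
  unfold cnt pr
  rw [Finset.card_eq_sum_card_fiberwise (f := z) (t := Finset.univ) (fun _ _ => by simp)]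
  simp [Finset.filter_filter]

lemma marg_right (x : Fin n → A) (z : Fin n → B) (b : B) :
    ∑ a, cnt (pr x z) (a, b) = cnt z b := by
  unfold cnt pr
  rw [Finset.card_eq_sum_card_fiberwise (f := x) (t := Finset.univ) (fun _ _ => by simp)]
  simp [Finset.filter_filter, and_comm]

lemma jclass_upper (x0 : Fin n → A) (z : Fin n → B) :
    (Finset.univ.filter fun x : Fin n → A => cnt (pr x z) = cnt (pr x0 z)).card
      * ∏ p, cnt (pr x0 z) p ^ cnt (pr x0 z) p ≤ ∏ b, cnt z b ^ cnt z b := by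
  have h1 : ∏ b, cnt z b ^ cnt z b = ∑ x : Fin n → A, ∏ i, cnt (pr x0 z) (x i, z i) := by
    have := Finset.prod_univ_sum (fun _ : Fin n => (Finset.univ : Finset A))
      (fun i a => cnt (pr x0 z) (a, z i))
    simp only [marg_right, Fintype.piFinset_univ] at this
    rw [← this, prod_cnt z]
  rw [h1, ← smul_eq_mul, ← Finset.sum_const]
  refine le_trans (le_of_eq ?_) (Finset.sum_le_sum_of_subset (Finset.filter_subset
    (fun x : Fin n → A => cnt (pr x z) = cnt (pr x0 z)) Finset.univ))
  refine Finset.sum_congr rfl fun x hx => ?_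
  rw [← (Finset.mem_filter.1 hx).2, ← prod_cnt (pr x z)]
  rfl

lemma two_pow_mutInfo (hn : 1 ≤ n) (x : Fin n → A) (z : Fin n → B) :
    (2 : ℝ) ^ ((n : ℝ) * mutInfo (empDist (pr x z)))
      * ((∏ a, (cnt x a : ℝ) ^ cnt x a) * ∏ b, (cnt z b : ℝ) ^ cnt z b)
      = (n : ℝ) ^ n * ∏ p, (cnt (pr x z) p : ℝ) ^ cnt (pr x z) p := by
  have hn0 : (n : ℝ) ≠ 0 := by positivity
  have e : ∀ p, empDist (pr x z) p = (cnt (pr x z) p : ℝ) / n := fun p => rfl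
  have mL : ∀ a, ∑ b, empDist (pr x z) (a, b) = (cnt x a : ℝ) / n := fun a => by
    simp only [e]; rw [← Finset.sum_div, ← marg_left x z a]; push_cast; rfl
  have mR : ∀ b, ∑ a, empDist (pr x z) (a, b) = (cnt z b : ℝ) / n := fun b => by
    simp only [e]; rw [← Finset.sum_div, ← marg_right x z b]; push_cast; rfl
  have h1 : (∏ a, (cnt x a : ℝ) ^ cnt x a) =
      ∏ p : A × B, (cnt x p.1 : ℝ) ^ cnt (pr x z) p := by
    rw [Fintype.prod_prod_type]
    refine Finset.prod_congr rfl fun a _ => ?_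
    simp only
    rw [Finset.prod_pow_eq_pow_sum, marg_left]
  have h2 : (∏ b, (cnt z b : ℝ) ^ cnt z b) =
      ∏ p : A × B, (cnt z p.2 : ℝ) ^ cnt (pr x z) p := by
    rw [Fintype.prod_prod_type_right]
    refine Finset.prod_congr rfl fun a _ => ?_
    simp only
    rw [Finset.prod_pow_eq_pow_sum, marg_right]
  have h3 : (n : ℝ) ^ n = ∏ p : A × B, (n : ℝ) ^ cnt (pr x z) p := by
    rw [Finset.prod_pow_eq_pow_sum, sum_cnt]
  unfold mutInfo
  rw [Finset.mul_sum, Real.rpow_sum_of_pos (by norm_num), h1, h2, h3,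
    ← Finset.prod_mul_distrib, ← Finset.prod_mul_distrib, ← Finset.prod_mul_distrib]
  refine Finset.prod_congr rfl fun p _ => ?_
  rw [mL, mR, e]
  rcases Nat.eq_zero_or_pos (cnt (pr x z) p) with h | h
  · simp [h]
  · have hx : 0 < cnt x p.1 := by
      rw [← marg_left x z p.1]
      exact Finset.sum_pos' (fun _ _ => Nat.zero_le _) ⟨p.2, Finset.mem_univ _, h⟩
    have hz : 0 < cnt z p.2 := by
      rw [← marg_right x z p.2]
      exact Finset.sum_pos' (fun _ _ => Nat.zero_le _) ⟨p.1, Finset.mem_univ _, h⟩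
    have hn' : (0 : ℝ) < n := by positivity
    have : (n : ℝ) * ((cnt (pr x z) p : ℝ) / n * Real.logb 2 ((cnt (pr x z) p : ℝ) / n /
        ((cnt x p.1 : ℝ) / n * ((cnt z p.2 : ℝ) / n)))) =
        Real.logb 2 ((cnt (pr x z) p : ℝ) / n /
        ((cnt x p.1 : ℝ) / n * ((cnt z p.2 : ℝ) / n))) * (cnt (pr x z) p : ℕ) := by
      field_simp
    rw [this, Real.rpow_mul_natCast (by norm_num),
      Real.rpow_logb (by norm_num) (by norm_num) (by positivity), ← mul_pow, ← mul_pow, ← mul_pow]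
    congr 1
    field_simp

end helpers

lemma mutInfo_nonneg {A B : Type*} [Fintype A] [Fintype B] (q : A × B → ℝ) (hq : IsDist q) :
    0 ≤ mutInfo q := by
  obtain ⟨h0, h1⟩ := hq
  set u : A → ℝ := fun a => ∑ b, q (a, b)
  set v : B → ℝ := fun b => ∑ a, q (a, b)
  have hu : ∑ a, u a = 1 := by rw [← h1, Fintype.sum_prod_type]
  have hv : ∑ b, v b = 1 := by rw [← h1, Fintype.sum_prod_type_right]
  have key : ∀ p : A × B, (q p - u p.1 * v p.2) / Real.log 2 ≤
      q p * Real.logb 2 (q p / (u p.1 * v p.2)) := by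
    intro p
    have hl : 0 < Real.log 2 := Real.log_pos (by norm_num)
    rw [Real.logb, ← mul_div_assoc]
    refine div_le_div_of_nonneg_right ?_ hl.le
    have hup : q p ≤ u p.1 :=
      Finset.single_le_sum (f := fun b => q (p.1, b)) (fun b _ => h0 _) (Finset.mem_univ p.2)
    have hvp : q p ≤ v p.2 :=
      Finset.single_le_sum (f := fun a => q (a, p.2)) (fun b _ => h0 _) (Finset.mem_univ p.1)
    rcases (h0 p).eq_or_lt with h | h
    · rw [← h] at hup hvp ⊢
      simpa using mul_nonneg hup hvp
    · have pu : 0 < u p.1 := h.trans_le hup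
      have pv : 0 < v p.2 := h.trans_le hvp
      have := Real.one_sub_inv_le_log_of_pos (x := q p / (u p.1 * v p.2)) (by positivity)
      calc q p - u p.1 * v p.2 = q p * (1 - (q p / (u p.1 * v p.2))⁻¹) := by field_simp
        _ ≤ _ := by gcongr
  have := Finset.sum_le_sum fun p (_ : p ∈ (Finset.univ : Finset (A × B))) => key p
  refine le_trans (le_of_eq ?_) this
  rw [← Finset.sum_div, Finset.sum_sub_distrib, h1, Fintype.sum_prod_type]
  simp only
  rw [← Finset.sum_mul_sum, hu, hv]
  simp

/-- **Blind-estimation exiguous-distortion bound on a type class.** If `X` is uniform on a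
nonempty type class `T_n(Q)`, then for every fixed `z ∈ 𝒵ⁿ`,
`P[d_E(X,z) ≤ D] ≤ (n+1)^{|𝒳|(|𝒵|+1)} · 2^{−n·R_{d_E}(Q,D)}`. -/
theorem blind_estimation_bound
    {𝓧 𝓩 : Type*} [Fintype 𝓧] [DecidableEq 𝓧] [Fintype 𝓩]
    (dE : 𝓧 → 𝓩 → ℝ) (hdE : ∀ x z, 0 ≤ dE x z) (D : ℝ) (hD : 0 ≤ D)
    {n : ℕ} (hn : 1 ≤ n)
    (Q : 𝓧 → ℝ) (hQ : (typeClass 𝓧 n Q).Nonempty) (z : Fin n → 𝓩) :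
    ((typeClass 𝓧 n Q ∩ {x | seqDist dE x z ≤ D}).ncard : ℝ)
        / ((typeClass 𝓧 n Q).ncard : ℝ)
      ≤ ((n : ℝ) + 1) ^ (Fintype.card 𝓧 * (Fintype.card 𝓩 + 1))
          * (2 : ℝ) ^ (-(n : ℝ) * rateDist dE Q D) := by
  classical
  have hn' : (0 : ℝ) < n := by positivity
  obtain ⟨x0, hx0⟩ := hQ
  have hQ0 : empDist x0 = Q := hx0
  have hT : typeClass 𝓧 n Q =
      ((Finset.univ.filter fun x : Fin n → 𝓧 => cnt x = cnt x0 : Finset _) : Set _) := by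
    ext x
    simp only [typeClass, ← hQ0, Set.mem_ofPred_eq, Finset.coe_filter, Finset.mem_univ, true_and]
    constructor
    · intro h
      funext a
      have := congrFun h a
      simp only [empDist] at this
      rw [div_left_inj' hn'.ne'] at this
      exact_mod_cast this
    · intro h
      funext a
      have := congrFun h a
      unfold cnt at this
      simp only [empDist, this]
  set S : Finset (Fin n → 𝓧) :=
    Finset.univ.filter fun x => cnt x = cnt x0 ∧ seqDist dE x z ≤ D with hS
  have hS' : typeClass 𝓧 n Q ∩ {x | seqDist dE x z ≤ D} = (S : Set _) := by
    rw [hT]; ext x; simp [hS]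
  rw [hS', hT, Set.ncard_coe_finset, Set.ncard_coe_finset]
  set T := (Finset.univ.filter fun x : Fin n → 𝓧 => cnt x = cnt x0).card with hTdef
  have hTpos : (0 : ℝ) < T := by
    have : 0 < T := Finset.card_pos.2 ⟨x0, by simp⟩
    exact_mod_cast this
  set R := rateDist dE Q D with hR
  -- bound on each joint class
  have key : ∀ x ∈ S,
      ((S.filter fun y => cnt (pr y z) = cnt (pr x z)).card : ℝ) ≤
        ((n : ℝ) + 1) ^ Fintype.card 𝓧 * (2 : ℝ) ^ (-(n : ℝ) * R) * T := by
    intro x hx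
    obtain ⟨hxc, hxD⟩ := (Finset.mem_filter.1 hx).2
    have hRI : R ≤ mutInfo (empDist (pr x z)) := by
      refine csInf_le ⟨0, ?_⟩ ⟨empDist (pr x z), ⟨fun p => ?_, ?_⟩, fun a => ?_, ?_, rfl⟩
      · rintro r ⟨q, hq, -, -, rfl⟩
        exact mutInfo_nonneg q hq
      · unfold empDist; positivity
      · have : ∑ p, (cnt (pr x z) p : ℝ) / n = 1 := by
          rw [← Finset.sum_div, ← Nat.cast_sum, sum_cnt, div_self hn'.ne']
        exact this
      · have : ∑ b, (cnt (pr x z) (a, b) : ℝ) / n = (cnt x0 a : ℝ) / n := by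
          rw [← Finset.sum_div, ← Nat.cast_sum, marg_left, hxc]
        rw [← hQ0]
        exact this
      · refine le_trans (le_of_eq ?_) hxD
        have h := sum_cnt_mul (pr x z) (fun p => dE p.1 p.2)
        have h' : ∑ i, dE (x i) (z i) = ∑ p, (cnt (pr x z) p : ℝ) * dE p.1 p.2 := h
        unfold seqDist
        rw [h', Finset.mul_sum]
        refine Finset.sum_congr rfl fun p _ => ?_
        change (cnt (pr x z) p : ℝ) / n * _ = _
        ring
    have h1 := two_pow_mutInfo hn x z
    have h2 : ((Finset.univ.filter fun y : Fin n → 𝓧 => cnt (pr y z) = cnt (pr x z)).card : ℝ)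
      * ∏ p, (cnt (pr x z) p : ℝ) ^ cnt (pr x z) p ≤ ∏ b, (cnt z b : ℝ) ^ cnt z b := by
      exact_mod_cast jclass_upper x z
    have h3 : (n : ℝ) ^ n ≤ ((n : ℝ) + 1) ^ Fintype.card 𝓧 *
        (T * ∏ a, (cnt x a : ℝ) ^ cnt x a) := by
      rw [hxc]; exact_mod_cast tclass_lower x0
    have pw : ∀ k : ℕ, (0 : ℝ) < (k : ℝ) ^ k := fun k => by
      exact_mod_cast Nat.pow_self_pos
    have pX : 0 < ∏ a, (cnt x a : ℝ) ^ cnt x a := Finset.prod_pos fun _ _ => pw _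
    have pZ : 0 < ∏ b, (cnt z b : ℝ) ^ cnt z b := Finset.prod_pos fun _ _ => pw _
    have pN : 0 < ∏ p, (cnt (pr x z) p : ℝ) ^ cnt (pr x z) p := Finset.prod_pos fun _ _ => pw _
    have h4 : ((S.filter fun y => cnt (pr y z) = cnt (pr x z)).card : ℝ) ≤
        ((Finset.univ.filter fun y : Fin n → 𝓧 => cnt (pr y z) = cnt (pr x z)).card : ℝ) := by
      exact_mod_cast Finset.card_le_card (Finset.filter_subset_filter _ (Finset.subset_univ _))
    refine h4.trans ?_
    have h5 : (2 : ℝ) ^ (-(n : ℝ) * mutInfo (empDist (pr x z))) ≤ (2 : ℝ) ^ (-(n : ℝ) * R) := by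
      refine Real.rpow_le_rpow_of_exponent_le (by norm_num) ?_
      nlinarith
    refine le_trans ?_ (mul_le_mul_of_nonneg_right
      (mul_le_mul_of_nonneg_left h5 (by positivity)) hTpos.le)
    rw [neg_mul, Real.rpow_neg (by norm_num)]
    set E := (2 : ℝ) ^ ((n : ℝ) * mutInfo (empDist (pr x z))) with hE
    have pE : 0 < E := by positivity
    set J := ((Finset.univ.filter fun y : Fin n → 𝓧 => cnt (pr y z) = cnt (pr x z)).card : ℝ)
    set PX := ∏ a, (cnt x a : ℝ) ^ cnt x a
    set PZ := ∏ b, (cnt z b : ℝ) ^ cnt z b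
    set PN := ∏ p, (cnt (pr x z) p : ℝ) ^ cnt (pr x z) p
    set C := ((n : ℝ) + 1) ^ Fintype.card 𝓧
    have h6 : J * E ≤ C * T := by
      refine le_of_mul_le_mul_right ?_ (mul_pos (mul_pos pX pZ) pN)
      calc J * E * (PX * PZ * PN) = (J * PN) * (E * (PX * PZ)) := by ring
        _ = (J * PN) * ((n : ℝ) ^ n * PN) := by rw [h1]
        _ ≤ PZ * ((C * (T * PX)) * PN) := by gcongr
        _ = _ := by ring
    rw [mul_right_comm, ← div_eq_mul_inv, le_div_iff₀ pE]
    exact h6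
  rw [div_le_iff₀ hTpos]
  have hcard := Finset.card_eq_sum_card_image (fun y : Fin n → 𝓧 => cnt (pr y z)) S
  rw [hcard, Nat.cast_sum]
  have hI : ((S.image fun y => cnt (pr y z)).card : ℝ) ≤
      ((n : ℝ) + 1) ^ (Fintype.card 𝓧 * Fintype.card 𝓩) := by
    have h := card_image_cnt (S.image fun y => pr y z)
    rw [Finset.image_image, Fintype.card_prod] at h
    exact_mod_cast h
  refine (Finset.sum_le_card_nsmul _ _
    (((n : ℝ) + 1) ^ Fintype.card 𝓧 * (2 : ℝ) ^ (-(n : ℝ) * R) * T) ?_).trans ?_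
  · intro m hm
    obtain ⟨x, hx, rfl⟩ := Finset.mem_image.1 hm
    exact key x hx
  · rw [nsmul_eq_mul]
    refine (mul_le_mul_of_nonneg_right hI (by positivity)).trans (le_of_eq ?_)
    rw [mul_add, pow_add, mul_one]
    ring

end
end
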